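/- Fix β ∈ (−1,1). As Δ = 2−α → 0⁺, the Fisher information of the scale parameter converges: I_{σσ}(α) = ∫_ℝ (f(x;α,β) + x·f′(x;α,β))² / f(x;α,β) dx → 2, the value of the scale information of the N(0,2) distribution. -/

import Mathlib

open MeasureTheory Filter Set Topology Real

/-- Shift parameter ζ = −β·tan(πα/2) in Zolotarev's (M) parameterization. -/
noncomputable def zetaPar (α β : ℝ) : ℝ := -β * Real.tan (Real.pi * α / 2)

/-- Standard stable density in Zolotarev's (M) parameterization, via the inversion formula. -/
noncomputable def stableDensity (α β x : ℝ) : ℝ :=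
  (1 / Real.pi) *
    (∫ t in Set.Ioi (0 : ℝ),
      Complex.exp (-(Complex.I * (t : ℂ) * (x : ℂ))) *
        Complex.exp (-(((t ^ α : ℝ) : ℂ)) *
          (1 + Complex.I * (β : ℂ) * ((Real.tan (Real.pi * α / 2) : ℝ) : ℂ) *
            (((t ^ (1 - α) : ℝ) : ℂ) - 1)))).re

/-- The N(0,2) density f(y;2). -/
noncomputable def normalDensity (y : ℝ) : ℝ :=
  (1 / (2 * Real.sqrt Real.pi)) * Real.exp (-(y ^ 2) / 4)

/-- Partial derivative of the stable density with respect to α. -/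
noncomputable def fAlpha (α β x : ℝ) : ℝ := deriv (fun a : ℝ => stableDensity a β x) α

/-- Partial derivative of the stable density with respect to β. -/
noncomputable def fBeta (α β x : ℝ) : ℝ := deriv (fun b : ℝ => stableDensity α b x) β

/-- Derivative of the stable density in x. -/
noncomputable def fX (α β x : ℝ) : ℝ := deriv (stableDensity α β) x

/-- The scale score numerator f_σ = −f − x·f′. -/
noncomputable def fSig (α β x : ℝ) : ℝ := -stableDensity α β x - x * fX α β x


/-- The exponent, extended to complex arguments. -/
noncomputable def psiC (D b : ℝ) (z : ℂ) : ℂ :=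
  z ^ ((2 - D : ℝ) : ℂ) * (1 - Complex.I * (b : ℂ)) + Complex.I * (b : ℂ) * z

/-- The integrand of the inversion formula, extended to complex arguments. -/
noncomputable def FC (D b x : ℝ) (z : ℂ) : ℂ :=
  Complex.exp (-(Complex.I * z * (x : ℂ)) - psiC D b z)

lemma cube_le_exp {y : ℝ} (hy : 0 ≤ y) : y ^ 3 ≤ 384 * Real.exp (y / 4) := by
  have h := Real.pow_div_factorial_le_exp (y / 4) (by positivity) 3
  norm_num [Nat.factorial] at h
  nlinarith

lemma norm_exp_sub_exp_le {a c : ℂ} {M : ℝ} (ha : a.re ≤ M) (hc : c.re ≤ M) :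
    ‖Complex.exp a - Complex.exp c‖ ≤ Real.exp M * ‖a - c‖ := by
  have hs : Convex ℝ {z : ℂ | z.re ≤ M} := convex_halfSpace_re_le M
  refine hs.norm_image_sub_le_of_norm_hasDerivWithin_le (f := Complex.exp) (f' := Complex.exp)
    (fun z _ => (Complex.hasDerivAt_exp z).hasDerivWithinAt) ?_ hc ha
  intro z hz
  rw [Complex.norm_exp]
  exact Real.exp_le_exp.mpr hz

lemma arg_quadrant {z : ℂ} (h1 : 0 ≤ z.re) (h2 : z.im ≤ 0) :
    -(π / 2) ≤ Complex.arg z ∧ Complex.arg z ≤ 0 := by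
  have := Complex.abs_arg_le_pi_div_two_iff.mpr h1
  rw [abs_le] at this
  refine ⟨this.1, ?_⟩
  rcases h2.lt_or_eq with h | h
  · exact (Complex.arg_neg_iff.mpr h).le
  · exact (Complex.arg_eq_zero_iff.mpr ⟨h1, h⟩).le

lemma cpow_re_lower {D : ℝ} (hD0 : 0 < D) (hD1 : D ≤ 1 / 2) {z : ℂ} (hz : z ≠ 0)
    (h1 : 0 ≤ z.re) (h2 : z.im ≤ 0) :
    ‖z‖ ^ (-D) * (z.re ^ 2 - z.im ^ 2) ≤ (z ^ ((2 - D : ℝ) : ℂ)).re := by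
  obtain ⟨ha, hb⟩ := arg_quadrant h1 h2
  have hr : 0 < ‖z‖ := norm_pos_iff.mpr hz
  rw [Complex.cpow_ofReal_re]
  have e1 : ‖z‖ ^ (2 - D) = ‖z‖ ^ (-D) * ‖z‖ ^ 2 := by
    rw [← Real.rpow_natCast, ← Real.rpow_add hr]; congr 1; push_cast; ring
  rw [e1, mul_assoc]
  refine mul_le_mul_of_nonneg_left ?_ (by positivity)
  have e2 : z.re ^ 2 - z.im ^ 2 = ‖z‖ ^ 2 * Real.cos (2 * Complex.arg z) := by
    rw [Real.cos_two_mul, Complex.cos_arg hz]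
    have := Complex.sq_norm_sub_sq_re z
    field_simp
    linarith
  rw [e2]
  refine mul_le_mul_of_nonneg_left ?_ (by positivity)
  rw [← Real.cos_neg (2 * _), ← Real.cos_neg (Complex.arg z * _)]
  apply Real.cos_le_cos_of_nonneg_of_le_pi
  · nlinarith
  · linarith
  · nlinarith

lemma psi_re_lower {D b : ℝ} (hD0 : 0 < D) (hb : |b| ≤ 4 * D) {u s : ℝ}
    (hu : 0 ≤ u) (hs : 0 ≤ s) (hDs : D * (1 + s ^ 2) ≤ 1 / 16) :
    u / 2 - s ^ 2 - 4 ≤ (psiC D b ⟨u, -s⟩).re := by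
  have hD1 : D ≤ 1 / 16 := by nlinarith [mul_nonneg hD0.le (sq_nonneg s)]
  by_cases hz : (⟨u, -s⟩ : ℂ) = 0
  · have hu0 : u = 0 := congrArg Complex.re hz
    have hs0 : s = 0 := by have := congrArg Complex.im hz; simpa using this
    rw [hz, hu0, hs0]
    have : ((2 - D : ℝ) : ℂ) ≠ 0 := by
      exact_mod_cast (by linarith : (2 - D : ℝ) ≠ 0)
    simp only [psiC, Complex.zero_cpow this]
    simp
  set z : ℂ := ⟨u, -s⟩ with hzd
  have h := cpow_re_lower hD0 (by linarith) hz (by simpa [hzd] using hu) (by simpa [hzd] using hs)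
  have hr : 0 < ‖z‖ := norm_pos_iff.mpr hz
  set r := ‖z‖ with hrd
  have hr2 : r ^ 2 = u ^ 2 + s ^ 2 := by
    rw [hrd, Complex.sq_norm, Complex.normSq_apply]; simp [hzd]; ring
  set w := z ^ ((2 - D : ℝ) : ℂ) with hw
  have hwn : ‖w‖ = r ^ (-D) * (u ^ 2 + s ^ 2) := by
    rw [hw, Complex.norm_cpow_real, ← hr2, ← Real.rpow_natCast, ← Real.rpow_add hr]
    congr 1; push_cast; ring
  have hre : (psiC D b z).re = w.re + b * w.im + b * s := by
    rw [psiC, ← hw]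
    have a1 : z.re = u := rfl
    have a2 : z.im = -s := rfl
    simp [a1, a2]; ring
  rw [hre]
  have hz1 : z.re = u := rfl
  have hz2 : z.im = -s := rfl
  rw [hz1, hz2] at h
  have him : |b * w.im| ≤ 4 * D * (r ^ (-D) * (u ^ 2 + s ^ 2)) := by
    rw [abs_mul, ← hwn]
    exact mul_le_mul hb (Complex.abs_im_le_norm w) (abs_nonneg _) (by positivity)
  have hbs : |b * s| ≤ 4 * D * (1 + s ^ 2) := by
    rw [abs_mul, abs_of_nonneg hs]
    calc |b| * s ≤ 4 * D * s := by gcongr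
      _ ≤ _ := by gcongr; nlinarith [sq_nonneg (s - 1)]
  have hq0 : 0 < r ^ (-D) := Real.rpow_pos_of_pos hr _
  set q := r ^ (-D) with hq
  have hqs : q * s ^ 2 ≤ 1 + s ^ 2 := by
    rcases le_or_gt 1 r with h1 | h1
    · have : q ≤ 1 := Real.rpow_le_one_of_one_le_of_nonpos h1 (by linarith)
      nlinarith [sq_nonneg s]
    · have : q * r ^ 2 ≤ 1 := by
        rw [hq, ← Real.rpow_natCast, ← Real.rpow_add hr]
        exact Real.rpow_le_one hr.le h1.le (by push_cast; linarith)
      nlinarith [sq_nonneg s, mul_nonneg hq0.le (sq_nonneg u)]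
  have hqu : u - 2 ≤ q * u ^ 2 := by
    have hrus : r ≤ u + s := by
      refine abs_le_of_sq_le_sq' ?_ (by positivity) |>.2; nlinarith [mul_nonneg hu hs]
    have h1 : r ^ D ≤ 2 + u := by
      have := rpow_one_add_le_one_add_mul_self (s := r - 1) (by linarith) hD0.le (by linarith)
      rw [add_sub_cancel] at this
      have h3 : D * s ≤ 1 / 16 := by nlinarith [sq_nonneg (s - 1), mul_nonneg hD0.le (sq_nonneg (s-1)), mul_nonneg hD0.le (sq_nonneg s)]
      have h4 : D * r ≤ D * (u + s) := by gcongr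
      nlinarith [mul_le_mul_of_nonneg_right hD1 hu]
    have h2 : q = (r ^ D)⁻¹ := Real.rpow_neg hr.le _
    have h3 : (2 + u)⁻¹ ≤ q := by
      rw [h2]; gcongr
      
    have h4 : (2 + u)⁻¹ * u ^ 2 ≤ q * u ^ 2 := by gcongr
    refine le_trans ?_ h4
    rw [inv_mul_eq_div, le_div_iff₀ (by positivity)]
    nlinarith
  have A := abs_le.mp him
  have B := abs_le.mp hbs
  have hqu2 : 0 ≤ q * u ^ 2 := by positivity
  have hqs2 : 0 ≤ q * s ^ 2 := by positivity
  have e1 : 4 * D * (q * u ^ 2) ≤ 1 / 4 * (q * u ^ 2) := by gcongr; linarith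
  have e2 : 4 * D * (q * s ^ 2) ≤ 4 * D * (1 + s ^ 2) := by gcongr
  nlinarith

lemma psi_sub_sq {D b : ℝ} (hD0 : 0 < D) (hD1 : D ≤ 1 / 2) (hb : |b| ≤ 4 * D) {z : ℂ}
    (h1 : 0 ≤ z.re) (h2 : z.im ≤ 0) :
    ‖psiC D b z - z ^ 2‖ ≤ 11 * D * (1 + ‖z‖ ^ 3) := by
  by_cases hz : z = 0
  · have : ((2 - D : ℝ) : ℂ) ≠ 0 := by
      exact_mod_cast (by linarith : (2 - D : ℝ) ≠ 0)
    rw [hz]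
    simp only [psiC, Complex.zero_cpow this]
    simp; linarith
  obtain ⟨ha, ha'⟩ := arg_quadrant h1 h2
  have hr : 0 < ‖z‖ := norm_pos_iff.mpr hz
  set r := ‖z‖ with hrd
  set w := z ^ ((2 - D : ℝ) : ℂ) with hw
  have hwn : ‖w‖ = r ^ (2 - D) := Complex.norm_cpow_real _ _
  have hwle : ‖w‖ ≤ 1 + r ^ 3 := by
    rw [hwn]
    rcases le_or_gt 1 r with h | h
    · calc r ^ (2 - D) ≤ r ^ (3 : ℝ) := Real.rpow_le_rpow_of_exponent_le h (by linarith)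
        _ ≤ _ := by norm_cast; linarith
    · have := Real.rpow_le_one hr.le h.le (by linarith : 0 ≤ 2 - D)
      have : 0 < r ^ 3 := by positivity
      linarith
  have hrle : r ≤ 1 + r ^ 3 := by
    rcases le_or_gt 1 r with h | h
    · nlinarith [sq_nonneg (r - 1), mul_pos hr hr]
    · have : 0 < r ^ 3 := by positivity
      linarith
  have e1 : psiC D b z - z ^ 2 = -(w * (z ^ ((D : ℝ) : ℂ) - 1)) + Complex.I * b * (z - w) := by
    have : z ^ 2 = w * z ^ ((D : ℝ) : ℂ) := by
      rw [hw, ← Complex.cpow_add _ _ hz]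
      push_cast
      rw [sub_add_cancel]
      norm_cast
    rw [this, psiC, ← hw]; ring
  have hlog : ‖Complex.log z‖ ≤ |Real.log r| + 2 := by
    have e : Complex.log z = (Real.log r : ℂ) + (Complex.arg z : ℂ) * Complex.I := by
      apply Complex.ext <;> simp [hrd, Complex.log_re, Complex.log_im]
    rw [e]
    refine (norm_add_le _ _).trans ?_
    simp only [norm_mul, Complex.norm_real, Complex.norm_I, mul_one, Real.norm_eq_abs]
    have : |Complex.arg z| ≤ 2 := by
      rw [abs_le]; constructor <;> linarith [Real.pi_le_four]
    linarith
  have e2 : ‖w * (z ^ ((D : ℝ) : ℂ) - 1)‖ ≤ 3 * D * (1 + r ^ 3) := by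
    rw [norm_mul, hwn]
    have hc : z ^ ((D : ℝ) : ℂ) = Complex.exp (Complex.log z * D) := by
      rw [Complex.cpow_def_of_ne_zero hz]
    have hre : (Complex.log z * D).re = D * Real.log r := by
      simp [hrd, mul_comm, Complex.log_re]
    have hnn : ‖Complex.log z * D - 0‖ ≤ D * (|Real.log r| + 2) := by
      rw [sub_zero, norm_mul, Complex.norm_real, Real.norm_eq_abs, abs_of_pos hD0, mul_comm]
      gcongr
    rcases le_or_gt 1 r with h | h
    · have hl0 : 0 ≤ Real.log r := Real.log_nonneg h
      have hl1 : Real.log r ≤ r := by linarith [Real.log_le_sub_one_of_pos hr]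
      have k := norm_exp_sub_exp_le (a := Complex.log z * D) (c := 0) (M := D * Real.log r)
        hre.le (by simp; positivity)
      rw [Complex.exp_zero, ← hc] at k
      have hE : Real.exp (D * Real.log r) = r ^ D := by
        rw [Real.rpow_def_of_pos hr, mul_comm]
      rw [hE] at k
      have hm : r ^ (2 - D) * r ^ D = r ^ 2 := by
        rw [← Real.rpow_add hr, sub_add_cancel]; norm_cast
      calc r ^ (2 - D) * ‖z ^ ((D : ℝ) : ℂ) - 1‖ ≤ r ^ (2 - D) * (r ^ D * (D * (|Real.log r| + 2))) := by
            gcongr; exact k.trans (by gcongr)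
        _ = r ^ 2 * (D * (Real.log r + 2)) := by rw [← mul_assoc, hm, abs_of_nonneg hl0]
        _ ≤ r ^ 2 * (D * (r + 2 * r)) := by gcongr; linarith
        _ ≤ _ := by nlinarith
    · have hl0 : Real.log r ≤ 0 := Real.log_nonpos hr.le h.le
      have k := norm_exp_sub_exp_le (a := Complex.log z * D) (c := 0) (M := 0)
        (by rw [hre]; nlinarith) (by simp)
      rw [Complex.exp_zero, ← hc, Real.exp_zero, one_mul] at k
      have hp : r ^ (2 - D) ≤ r := by
        conv_rhs => rw [← Real.rpow_one r]
        exact Real.rpow_le_rpow_of_exponent_ge hr h.le (by linarith)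
      have hl2 : r * |Real.log r| ≤ 1 := by
        have := Real.abs_log_mul_self_lt r hr h.le
        rw [abs_mul, abs_of_pos hr] at this; linarith
      calc r ^ (2 - D) * ‖z ^ ((D : ℝ) : ℂ) - 1‖ ≤ r * (D * (|Real.log r| + 2)) := by
            gcongr; exact k.trans hnn
        _ = D * (r * |Real.log r| + 2 * r) := by ring
        _ ≤ D * (1 + 2 * 1) := by gcongr
        _ ≤ _ := by nlinarith [pow_pos hr 3, mul_pos hD0 (pow_pos hr 3)]
  rw [e1]
  refine (norm_add_le _ _).trans ?_
  rw [norm_neg, norm_mul (Complex.I * (b : ℂ)), norm_mul Complex.I, Complex.norm_I, one_mul, Complex.norm_real, Real.norm_eq_abs]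
  have e3 : ‖z - w‖ ≤ 2 * (1 + r ^ 3) := (norm_sub_le _ _).trans (by linarith)
  have e4 : |b| * ‖z - w‖ ≤ 4 * D * (2 * (1 + r ^ 3)) := by gcongr
  nlinarith

lemma integrableOn_exp_quarter : IntegrableOn (fun u : ℝ => Real.exp (-u / 4)) (Ioi 0) := by
  have := integrableOn_exp_mul_Ioi (a := -(1 / 4)) (by norm_num) 0
  refine this.congr_fun (fun u _ => ?_) measurableSet_Ioi
  simp only; congr 1; ring

lemma integral_exp_quarter : ∫ u in Ioi (0 : ℝ), Real.exp (-u / 4) = 4 := by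
  have := integral_exp_mul_Ioi (a := -(1 / 4)) (by norm_num) 0
  have e : ∀ u : ℝ, -u / 4 = -(1 / 4) * u := fun u => by ring
  simp only [e]
  rw [this]; norm_num

lemma continuous_mk_left (c : ℝ) : Continuous (fun u : ℝ => (⟨u, c⟩ : ℂ)) := by
  have : (fun u : ℝ => (⟨u, c⟩ : ℂ)) = fun u : ℝ => (u : ℂ) + (c : ℂ) * Complex.I := by
    funext u; exact Complex.mk_eq_add_mul_I u c
  rw [this]; fun_prop

lemma continuous_mk_right (c : ℝ) : Continuous (fun s : ℝ => (⟨c, -s⟩ : ℂ)) := by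
  have : (fun s : ℝ => (⟨c, -s⟩ : ℂ)) = fun s : ℝ => (c : ℂ) + ((-s : ℝ) : ℂ) * Complex.I := by
    funext u; exact Complex.mk_eq_add_mul_I c (-u)
  rw [this]; fun_prop

lemma quad_integrable {Φ : ℂ → ℂ} {h M : ℝ} (hh : 0 ≤ h)
    (hc : ContinuousOn Φ {z | 0 ≤ z.re ∧ z.im ≤ 0})
    (hb : ∀ u, 0 ≤ u → ‖Φ ⟨u, -h⟩‖ ≤ M * Real.exp (-u / 4)) :
    IntegrableOn (fun u : ℝ => Φ ⟨u, -h⟩) (Ioi 0) := by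
  refine Integrable.mono' (integrableOn_exp_quarter.const_mul M) ?_ ?_
  · refine ContinuousOn.aestronglyMeasurable ?_ measurableSet_Ioi
    refine hc.comp (continuous_mk_left (-h)).continuousOn ?_
    intro u hu
    exact ⟨le_of_lt hu, by simpa using hh⟩
  · filter_upwards [ae_restrict_mem measurableSet_Ioi] with u hu
    exact hb u (le_of_lt hu)

lemma contour {Φ : ℂ → ℂ} {h M : ℝ} (hh : 0 ≤ h)
    (hc : ContinuousOn Φ {z | 0 ≤ z.re ∧ z.im ≤ 0})
    (hd : DifferentiableOn ℂ Φ {z | 0 < z.re ∧ z.im < 0})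
    (hb : ∀ u s, 0 ≤ u → 0 ≤ s → s ≤ h → ‖Φ ⟨u, -s⟩‖ ≤ M * Real.exp (-u / 4)) :
    ∫ u in Ioi (0 : ℝ), Φ ⟨u, 0⟩ =
      -Complex.I * (∫ s in (0 : ℝ)..h, Φ ⟨0, -s⟩) + ∫ u in Ioi (0 : ℝ), Φ ⟨u, -h⟩ := by
  have i0 : IntegrableOn (fun u : ℝ => Φ ⟨u, 0⟩) (Ioi 0) := by
    have := quad_integrable le_rfl hc (fun u hu => hb u 0 hu le_rfl hh)
    simpa using this
  have ih : IntegrableOn (fun u : ℝ => Φ ⟨u, -h⟩) (Ioi 0) :=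
    quad_integrable hh hc (fun u hu => hb u h hu hh le_rfl)
  have t0 := intervalIntegral_tendsto_integral_Ioi 0 i0 tendsto_id
  have th := intervalIntegral_tendsto_integral_Ioi 0 ih tendsto_id
  have hside : Tendsto (fun T : ℝ => Complex.I • ∫ y in (-h)..(0 : ℝ), Φ ⟨T, y⟩) atTop (𝓝 0) := by
    have hz : Tendsto (fun T : ℝ => M * Real.exp (-T / 4) * h) atTop (𝓝 (M * 0 * h)) := by
      refine (Tendsto.const_mul M ?_).mul_const h
      refine Real.tendsto_exp_atBot.comp ?_
      have : (fun T : ℝ => -T / 4) = fun T : ℝ => -(T / 4) := by funext T; ring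
      rw [this]
      exact tendsto_neg_atTop_atBot.comp (tendsto_id.atTop_div_const (by norm_num))
    simp only [mul_zero, zero_mul] at hz
    refine squeeze_zero_norm' ?_ hz
    filter_upwards [eventually_ge_atTop 0] with T hT
    rw [norm_smul, Complex.norm_I, one_mul]
    have := intervalIntegral.norm_integral_le_of_norm_le_const (a := -h) (b := 0)
      (f := fun y => Φ ⟨T, y⟩) (C := M * Real.exp (-T / 4)) ?_
    · simpa [abs_of_nonneg hh] using this
    · intro y hy
      rw [uIoc_of_le (by linarith)] at hy
      have := hb T (-y) hT (by linarith [hy.2]) (by linarith [hy.1])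
      simpa using this
  have key : ∀ T : ℝ, 0 ≤ T → (∫ x in (0 : ℝ)..T, Φ ⟨x, 0⟩) =
      (∫ x in (0 : ℝ)..T, Φ ⟨x, -h⟩) + (Complex.I • ∫ y in (-h)..(0 : ℝ), Φ ⟨T, y⟩)
        - Complex.I • ∫ y in (-h)..(0 : ℝ), Φ ⟨0, y⟩ := by
    intro T hT
    have R := Complex.integral_boundary_rect_eq_zero_of_continuousOn_of_differentiableOn Φ
      ⟨0, -h⟩ ⟨T, 0⟩ ?_ ?_
    · simp only [← Complex.mk_eq_add_mul_I] at R
      rw [← sub_eq_zero, ← neg_eq_zero, ← R]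
      abel
    · refine hc.mono ?_
      intro z hz
      rw [Complex.mem_reProdIm] at hz
      simp only [uIcc_of_le hT, uIcc_of_le (neg_nonpos.mpr hh)] at hz
      exact ⟨hz.1.1, hz.2.2⟩
    · refine hd.mono ?_
      intro z hz
      rw [Complex.mem_reProdIm] at hz
      simp only [min_eq_left hT, max_eq_right hT, min_eq_left (neg_nonpos.mpr hh),
        max_eq_right (neg_nonpos.mpr hh)] at hz
      exact ⟨hz.1.1, hz.2.2⟩
  have lim2 : Tendsto (fun T : ℝ => ∫ x in (0 : ℝ)..T, Φ ⟨x, 0⟩) atTop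
      (𝓝 ((∫ u in Ioi (0 : ℝ), Φ ⟨u, -h⟩) + 0 - Complex.I • ∫ y in (-h)..(0 : ℝ), Φ ⟨0, y⟩)) := by
    refine ((th.add hside).sub_const _).congr' ?_
    filter_upwards [eventually_ge_atTop 0] with T hT
    exact (key T hT).symm
  have E := tendsto_nhds_unique t0 lim2
  rw [E]
  have hneg : (∫ s in (0 : ℝ)..h, Φ ⟨0, -s⟩) = ∫ y in (-h)..(0 : ℝ), Φ ⟨0, y⟩ := by
    have := intervalIntegral.integral_comp_neg (a := 0) (b := h) (fun y => Φ ⟨0, y⟩)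
    simpa using this
  rw [hneg, smul_eq_mul]; ring

lemma psiC_continuousOn {D b : ℝ} (hD1 : D ≤ 1 / 2) :
    ContinuousOn (psiC D b) {z | 0 ≤ z.re ∧ z.im ≤ 0} := by
  intro z hz
  refine ContinuousAt.continuousWithinAt ?_
  have h := Complex.continuousAt_cpow_const_of_re_pos (z := z) (w := ((2 - D : ℝ) : ℂ))
    (Or.inl hz.1) (by rw [Complex.ofReal_re]; linarith)
  unfold psiC
  exact (h.mul continuousAt_const).add (continuousAt_const.mul continuousAt_id)

lemma FC_continuousOn {D b x : ℝ} (hD1 : D ≤ 1 / 2) :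
    ContinuousOn (FC D b x) {z | 0 ≤ z.re ∧ z.im ≤ 0} := by
  unfold FC
  have := psiC_continuousOn (b := b) hD1
  fun_prop

lemma FC_differentiableOn {D b x : ℝ} :
    DifferentiableOn ℂ (FC D b x) {z | 0 < z.re ∧ z.im < 0} := by
  intro z hz
  refine DifferentiableAt.differentiableWithinAt ?_
  have hs : z ∈ Complex.slitPlane := Or.inl hz.1
  have h : DifferentiableAt ℂ (fun z : ℂ => z ^ ((2 - D : ℝ) : ℂ)) z :=
    differentiableAt_id.cpow_const hs
  unfold FC psiC
  fun_prop

lemma FC_norm (D b x u s : ℝ) :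
    ‖FC D b x ⟨u, -s⟩‖ = Real.exp (-(x * s) - (psiC D b ⟨u, -s⟩).re) := by
  rw [FC, Complex.norm_exp]
  congr 1
  simp; ring

lemma FC_bound {D b : ℝ} (hD0 : 0 < D) (hb : |b| ≤ 4 * D) (x : ℝ) {u s : ℝ}
    (hu : 0 ≤ u) (hs : 0 ≤ s) (hDs : D * (1 + s ^ 2) ≤ 1 / 16) :
    ‖FC D b x ⟨u, -s⟩‖ ≤ Real.exp (4 + s ^ 2 - x * s) * Real.exp (-u / 2) := by
  rw [FC_norm, ← Real.exp_add]
  apply Real.exp_le_exp.mpr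
  linarith [psi_re_lower hD0 hb hu hs hDs]

lemma lin_exp {u : ℝ} : (1 + u) * Real.exp (-u / 2) ≤ 4 * Real.exp (-u / 4) := by
  have h : 1 + u ≤ 4 * Real.exp (u / 4) := by linarith [Real.add_one_le_exp (u / 4)]
  calc (1 + u) * Real.exp (-u / 2) ≤ 4 * Real.exp (u / 4) * Real.exp (-u / 2) := by gcongr
    _ = 4 * Real.exp (-u / 4) := by rw [mul_assoc, ← Real.exp_add]; congr 2; ring

lemma norm_mk_le {u s : ℝ} (hu : 0 ≤ u) (hs : 0 ≤ s) : ‖(⟨u, -s⟩ : ℂ)‖ ≤ u + s := by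
  have := Complex.norm_le_abs_re_add_abs_im (⟨u, -s⟩ : ℂ)
  simpa [abs_of_nonneg hu, abs_of_nonneg hs] using this

/-- combined bound for the integrand and for the integrand times `1 + ‖z‖` -/
lemma FC_bound' {D b : ℝ} (hD0 : 0 < D) (hb : |b| ≤ 4 * D) (x : ℝ) {u s : ℝ}
    (hu : 0 ≤ u) (hs : 0 ≤ s) (hDs : D * (1 + s ^ 2) ≤ 1 / 16) :
    (1 + ‖(⟨u, -s⟩ : ℂ)‖) * ‖FC D b x ⟨u, -s⟩‖ ≤
      4 * (1 + s) * Real.exp (4 + s ^ 2 - x * s) * Real.exp (-u / 4) := by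
  have h1 := FC_bound hD0 hb x hu hs hDs
  have h2 := norm_mk_le hu hs
  calc (1 + ‖(⟨u, -s⟩ : ℂ)‖) * ‖FC D b x ⟨u, -s⟩‖
      ≤ ((1 + s) * (1 + u)) * (Real.exp (4 + s ^ 2 - x * s) * Real.exp (-u / 2)) := by
        gcongr; nlinarith
    _ = (1 + s) * Real.exp (4 + s ^ 2 - x * s) * ((1 + u) * Real.exp (-u / 2)) := by ring
    _ ≤ (1 + s) * Real.exp (4 + s ^ 2 - x * s) * (4 * Real.exp (-u / 4)) := by
        exact mul_le_mul_of_nonneg_left (lin_exp) (by positivity)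
    _ = _ := by ring

lemma FC_bound_unif {D b : ℝ} (hD0 : 0 < D) (hb : |b| ≤ 4 * D) {x : ℝ} (hx : 0 ≤ x) {u s h : ℝ}
    (hu : 0 ≤ u) (hs : 0 ≤ s) (hsh : s ≤ h) (hDs : D * (1 + h ^ 2) ≤ 1 / 16) :
    (1 + ‖(⟨u, -s⟩ : ℂ)‖) * ‖FC D b x ⟨u, -s⟩‖ ≤
      4 * (1 + h) * Real.exp (4 + h ^ 2) * Real.exp (-u / 4) := by
  have hs2 : s ^ 2 ≤ h ^ 2 := by gcongr
  refine (FC_bound' hD0 hb x hu hs (le_trans (by gcongr) hDs)).trans ?_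
  have : 0 ≤ x * s := by positivity
  have hh0 : 0 ≤ h := hs.trans hsh
  have h3 : Real.exp (4 + s ^ 2 - x * s) ≤ Real.exp (4 + h ^ 2) :=
    Real.exp_le_exp.mpr (by linarith)
  gcongr

lemma stableDensity_eq (D β x : ℝ) :
    stableDensity (2 - D) β x = (1 / π) *
      (∫ u in Ioi (0 : ℝ), FC D (β * Real.tan (π * (2 - D) / 2)) x ⟨u, 0⟩).re := by
  unfold stableDensity
  congr 2
  refine setIntegral_congr_fun measurableSet_Ioi ?_
  intro t ht
  have ht : 0 < t := ht
  simp only [FC, psiC]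
  rw [← Complex.exp_add]
  congr 1
  have e1 : (⟨t, 0⟩ : ℂ) = (t : ℂ) := rfl
  rw [e1, ← Complex.ofReal_cpow ht.le]
  have e2 : t ^ (2 - D) * t ^ (1 - (2 - D)) = t := by
    rw [← Real.rpow_add ht]; ring_nf; simp
  have e3 : ((t ^ (2 - D) : ℝ) : ℂ) * ((t ^ (1 - (2 - D)) : ℝ) : ℂ) = (t : ℂ) := by
    exact_mod_cast e2
  push_cast
  linear_combination (-Complex.I * β * (Complex.tan (π * (2 - D) / 2))) * e3

lemma hasDerivAt_integral_FC {D b : ℝ} (hD0 : 0 < D) (hD1 : D ≤ 1 / 16) (hb : |b| ≤ 4 * D) (x : ℝ) :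
    HasDerivAt (fun y : ℝ => ∫ u in Ioi (0 : ℝ), FC D b y ⟨u, 0⟩)
      (∫ u in Ioi (0 : ℝ), -Complex.I * (⟨u, 0⟩ : ℂ) * FC D b x ⟨u, 0⟩) x := by
  have hB : ∀ y u : ℝ, 0 ≤ u → (1 + ‖(⟨u, 0⟩ : ℂ)‖) * ‖FC D b y ⟨u, 0⟩‖ ≤
      4 * Real.exp 4 * Real.exp (-u / 4) := by
    intro y u hu
    have := FC_bound' hD0 hb y hu le_rfl (by simpa using hD1)
    simpa using this
  have hmem : ∀ u : ℝ, u ∈ Ioi (0 : ℝ) → (⟨u, 0⟩ : ℂ) ∈ {z : ℂ | 0 ≤ z.re ∧ z.im ≤ 0} :=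
    fun u hu => ⟨le_of_lt hu, le_rfl⟩
  have hcF : ∀ y, ContinuousOn (fun u : ℝ => FC D b y ⟨u, 0⟩) (Ioi 0) := fun y =>
    (FC_continuousOn (by linarith)).comp (continuous_mk_left 0).continuousOn hmem
  have hcF' : ContinuousOn (fun u : ℝ => -Complex.I * (⟨u, 0⟩ : ℂ) * FC D b x ⟨u, 0⟩) (Ioi 0) :=
    (continuousOn_const.mul (continuous_mk_left 0).continuousOn).mul (hcF x)
  refine (hasDerivAt_integral_of_dominated_loc_of_deriv_le (s := univ)
    (F := fun y u => FC D b y ⟨u, 0⟩) (μ := volume.restrict (Ioi (0 : ℝ)))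
    (F' := fun y u => -Complex.I * (⟨u, 0⟩ : ℂ) * FC D b y ⟨u, 0⟩)
    (bound := fun u => 4 * Real.exp 4 * Real.exp (-u / 4)) Filter.univ_mem ?_ ?_ ?_ ?_ ?_ ?_).2
  · exact Filter.Eventually.of_forall fun y => (hcF y).aestronglyMeasurable measurableSet_Ioi
  · refine Integrable.mono' (integrableOn_exp_quarter.const_mul (4 * Real.exp 4))
      ((hcF x).aestronglyMeasurable measurableSet_Ioi) ?_
    filter_upwards [ae_restrict_mem measurableSet_Ioi] with u hu
    refine le_trans ?_ (hB x u (le_of_lt hu))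
    nlinarith [norm_nonneg (⟨u, 0⟩ : ℂ), norm_nonneg (FC D b x ⟨u, 0⟩)]
  · exact hcF'.aestronglyMeasurable measurableSet_Ioi
  · filter_upwards [ae_restrict_mem measurableSet_Ioi] with u hu y _
    refine le_trans ?_ (hB y u (le_of_lt hu))
    rw [norm_mul, norm_mul, norm_neg, Complex.norm_I]
    nlinarith [norm_nonneg (⟨u, 0⟩ : ℂ), norm_nonneg (FC D b y ⟨u, 0⟩)]
  · exact integrableOn_exp_quarter.const_mul _
  · refine Filter.Eventually.of_forall fun u y _ => ?_
    have h1 : HasDerivAt (fun y : ℝ => (y : ℂ)) 1 y := Complex.ofRealCLM.hasDerivAt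
    have h2 := ((h1.const_mul (Complex.I * (⟨u, 0⟩ : ℂ))).neg.sub_const (psiC D b ⟨u, 0⟩)).cexp
    refine h2.congr_deriv ?_
    simp only [FC, Pi.neg_apply]
    ring

lemma hasDerivAt_stableDensity {D β : ℝ} (hD0 : 0 < D) (hD1 : D ≤ 1 / 16)
    (hb : |β * Real.tan (π * (2 - D) / 2)| ≤ 4 * D) (x : ℝ) :
    HasDerivAt (stableDensity (2 - D) β) ((1 / π) *
      (∫ u in Ioi (0 : ℝ), -Complex.I * (⟨u, 0⟩ : ℂ) *
        FC D (β * Real.tan (π * (2 - D) / 2)) x ⟨u, 0⟩).re) x := by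
  have h := hasDerivAt_integral_FC hD0 hD1 hb x
  have h2 := (Complex.reCLM.hasFDerivAt.comp_hasDerivAt x h).const_mul (1 / π)
  refine (h2.congr_deriv (by simp)).congr_of_eventuallyEq ?_
  exact Filter.Eventually.of_forall fun y => stableDensity_eq D β y

lemma tan_bound {D β : ℝ} (hD0 : 0 < D) (hD1 : D ≤ 1 / 16) (hβ : β ∈ Ioo (-1 : ℝ) 1) :
    |β * Real.tan (π * (2 - D) / 2)| ≤ 4 * D := by
  have e : π * (2 - D) / 2 = π - π * D / 2 := by ring
  have hp := Real.pi_pos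
  have hp4 := Real.pi_le_four
  have hy0 : 0 ≤ π * D / 2 := by positivity
  have hy1 : π * D / 2 ≤ 2 * D := by nlinarith
  set y := π * D / 2
  have hc : 1 / 2 ≤ Real.cos y := by
    have := Real.one_sub_sq_div_two_le_cos (x := y)
    nlinarith
  have hs : |Real.sin y| ≤ y := by
    rw [abs_of_nonneg (Real.sin_nonneg_of_nonneg_of_le_pi hy0 (by linarith [Real.pi_gt_three]))]
    exact Real.sin_le hy0
  rw [e, Real.tan_pi_sub, abs_mul, abs_neg, Real.tan_eq_sin_div_cos, abs_div,
    abs_of_pos (by linarith : 0 < Real.cos y)]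
  have h1 : |Real.sin y| / Real.cos y ≤ 4 * D := by
    rw [div_le_iff₀ (by linarith)]
    nlinarith
  have h2 : |β| ≤ 1 := abs_le.mpr ⟨hβ.1.le, hβ.2.le⟩
  have h3 : 0 ≤ |Real.sin y| / Real.cos y := div_nonneg (abs_nonneg _) (by linarith)
  nlinarith [abs_nonneg β]

/-- the coefficient of the phase on the vertical part of the contour -/
lemma phase_coeff {D β : ℝ} (hD0 : 0 < D) (hD1 : D ≤ 1 / 16) (hβ : β ∈ Ioo (-1 : ℝ) 1) :
    (1 + β) * D ≤ Real.sin (π * (2 - D) / 2) +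
        β * Real.tan (π * (2 - D) / 2) * Real.cos (π * (2 - D) / 2) ∧
      Real.sin (π * (2 - D) / 2) +
        β * Real.tan (π * (2 - D) / 2) * Real.cos (π * (2 - D) / 2) ≤ 4 * D := by
  have e : π * (2 - D) / 2 = π - π * D / 2 := by ring
  have hp := Real.pi_pos
  have hp4 := Real.pi_le_four
  have hy0 : 0 ≤ π * D / 2 := by positivity
  have hy1 : π * D / 2 ≤ 2 * D := by nlinarith
  have hl : D ≤ Real.sin (π * D / 2) := by
    have := Real.mul_le_sin hy0 (by nlinarith)
    have e : 2 / π * (π * D / 2) = D := by field_simp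
    linarith
  have hu : Real.sin (π * D / 2) ≤ 2 * D := (Real.sin_le hy0).trans hy1
  have hc : Real.cos (π * (2 - D) / 2) ≠ 0 := by
    rw [e, Real.cos_pi_sub]
    have := Real.one_sub_sq_div_two_le_cos (x := π * D / 2)
    have : 0 < Real.cos (π * D / 2) := by nlinarith
    linarith
  rw [mul_assoc, Real.tan_mul_cos hc, e, Real.sin_pi_sub]
  constructor <;> nlinarith [hβ.1, hβ.2]

lemma FC_vert_im {D b x s : ℝ} (hs : 0 ≤ s) (hD1 : D ≤ 1 / 16) :
    (FC D b x ⟨0, -s⟩).im = Real.exp (-(x * s) - (psiC D b ⟨0, -s⟩).re) *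
      Real.sin ((Real.sin (π * (2 - D) / 2) + b * Real.cos (π * (2 - D) / 2)) * s ^ (2 - D)) := by
  have hα : (2 - D : ℝ) ≠ 0 := by linarith
  have hre : ((⟨0, -s⟩ : ℂ) ^ ((2 - D : ℝ) : ℂ)).re = s ^ (2 - D) * Real.cos (π * (2 - D) / 2) ∧
      ((⟨0, -s⟩ : ℂ) ^ ((2 - D : ℝ) : ℂ)).im = -(s ^ (2 - D) * Real.sin (π * (2 - D) / 2)) := by
    rcases hs.eq_or_lt with h | h
    · subst h
      have : (⟨0, -0⟩ : ℂ) = 0 := by apply Complex.ext <;> simp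
      rw [this, Complex.zero_cpow (by exact_mod_cast hα), Real.zero_rpow hα]; simp
    · have hn : ‖(⟨0, -s⟩ : ℂ)‖ = s := by
        rw [Complex.norm_eq_sqrt_sq_add_sq]; simp [hs]
      have ha : Complex.arg (⟨0, -s⟩ : ℂ) = -(π / 2) := by
        rw [Complex.arg_eq_neg_pi_div_two_iff]; simpa using h
      rw [Complex.cpow_ofReal_re, Complex.cpow_ofReal_im, hn, ha]
      have : -(π / 2) * (2 - D) = -(π * (2 - D) / 2) := by ring
      rw [this, Real.cos_neg, Real.sin_neg]
      exact ⟨rfl, by ring⟩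
  have hi : (-(Complex.I * (⟨0, -s⟩ : ℂ) * (x : ℂ)) - psiC D b ⟨0, -s⟩).im =
      (Real.sin (π * (2 - D) / 2) + b * Real.cos (π * (2 - D) / 2)) * s ^ (2 - D) := by
    rw [psiC]
    set w := (⟨0, -s⟩ : ℂ) ^ ((2 - D : ℝ) : ℂ)
    simp [hre.1, hre.2]; ring
  have hr : (-(Complex.I * (⟨0, -s⟩ : ℂ) * (x : ℂ)) - psiC D b ⟨0, -s⟩).re =
      -(x * s) - (psiC D b ⟨0, -s⟩).re := by
    simp; ring
  rw [FC, Complex.exp_im, hi, hr]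

lemma rpow_le_one_add_sq {D s : ℝ} (hD0 : 0 < D) (hD1 : D ≤ 1 / 16) (hs : 0 ≤ s) :
    s ^ (2 - D) ≤ 1 + s ^ 2 := by
  rcases le_or_gt 1 s with h | h
  · calc s ^ (2 - D) ≤ s ^ (2 : ℝ) := Real.rpow_le_rpow_of_exponent_le h (by linarith)
      _ ≤ _ := by norm_cast; linarith
  · have := Real.rpow_le_one hs h.le (by linarith : 0 ≤ 2 - D)
    nlinarith

/-- the value of `b` for the stable density -/
noncomputable def bb (D β : ℝ) : ℝ := β * Real.tan (π * (2 - D) / 2)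

lemma vert_bounds {D β x s : ℝ} (hD0 : 0 < D) (hβ : β ∈ Ioo (-1 : ℝ) 1)
    (hs : 0 ≤ s) (hDs : D * (1 + s ^ 2) ≤ 1 / 16) :
    Real.exp (-(x * s) - (psiC D (bb D β) ⟨0, -s⟩).re) * ((1 + β) * D / 2 * s ^ (2 - D)) ≤
        (FC D (bb D β) x ⟨0, -s⟩).im ∧
      0 ≤ (FC D (bb D β) x ⟨0, -s⟩).im ∧
      (FC D (bb D β) x ⟨0, -s⟩).im ≤ Real.exp (4 + s ^ 2 - x * s) * (4 * D * s ^ (2 - D)) := by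
  have hD1 : D ≤ 1 / 16 := by nlinarith [mul_nonneg hD0.le (sq_nonneg s)]
  obtain ⟨k1, k2⟩ := phase_coeff hD0 hD1 hβ
  have hb := tan_bound hD0 hD1 hβ
  rw [FC_vert_im hs hD1]
  unfold bb
  set k := Real.sin (π * (2 - D) / 2) +
        β * Real.tan (π * (2 - D) / 2) * Real.cos (π * (2 - D) / 2)
  have hp0 : 0 ≤ s ^ (2 - D) := Real.rpow_nonneg hs _
  have hp1 := rpow_le_one_add_sq hD0 hD1 hs
  have hβ0 : 0 < 1 + β := by linarith [hβ.1]
  have hk0 : 0 ≤ k := le_trans (by positivity) k1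
  have ha0 : 0 ≤ k * s ^ (2 - D) := by positivity
  have ha1 : k * s ^ (2 - D) ≤ 1 / 4 := by
    calc k * s ^ (2 - D) ≤ 4 * D * (1 + s ^ 2) := by gcongr
      _ ≤ _ := by linarith
  have hsin1 : k * s ^ (2 - D) / 2 ≤ Real.sin (k * s ^ (2 - D)) := by
    have := Real.mul_le_sin ha0 (by linarith [Real.pi_gt_three])
    refine le_trans ?_ this
    have h2 : 1 / 2 ≤ 2 / π := by
      rw [le_div_iff₀ Real.pi_pos]; linarith [Real.pi_le_four]
    nlinarith
  have hsin2 : Real.sin (k * s ^ (2 - D)) ≤ k * s ^ (2 - D) := Real.sin_le ha0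
  have hpsi := psi_re_lower hD0 hb le_rfl hs hDs
  refine ⟨?_, ?_, ?_⟩
  · refine mul_le_mul_of_nonneg_left ?_ (Real.exp_nonneg _)
    refine le_trans ?_ hsin1
    have := mul_le_mul_of_nonneg_right k1 hp0
    linarith
  · exact mul_nonneg (Real.exp_nonneg _) (le_trans (by positivity) hsin1)
  · refine mul_le_mul ?_ ?_ (le_trans (by positivity) hsin1) (Real.exp_nonneg _)
    · apply Real.exp_le_exp.mpr; linarith
    · exact hsin2.trans (by gcongr)

lemma vert_cont {D b x h : ℝ} (hh : 0 ≤ h) (hD1 : D ≤ 1 / 16) :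
    ContinuousOn (fun s : ℝ => FC D b x ⟨0, -s⟩) (uIcc 0 h) := by
  refine (FC_continuousOn (by linarith)).comp (continuous_mk_right 0).continuousOn ?_
  intro s hs
  rw [uIcc_of_le hh] at hs
  exact ⟨le_rfl, by simpa using hs.1⟩

lemma vert_im_int {D b x h : ℝ} (hh : 0 ≤ h) (hD1 : D ≤ 1 / 16) :
    IntervalIntegrable (fun s : ℝ => (FC D b x ⟨0, -s⟩).im) volume 0 h :=
  (Complex.continuous_im.comp_continuousOn (vert_cont hh hD1)).intervalIntegrable

lemma vert_im_int' {D b x h : ℝ} (hh : 0 ≤ h) (hD1 : D ≤ 1 / 16) :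
    IntervalIntegrable (fun s : ℝ => s * (FC D b x ⟨0, -s⟩).im) volume 0 h :=
  (continuousOn_id.mul
    (Complex.continuous_im.comp_continuousOn (vert_cont hh hD1))).intervalIntegrable

lemma decomp {D β x h : ℝ} (hD0 : 0 < D) (hβ : β ∈ Ioo (-1 : ℝ) 1) (hx : 0 ≤ x) (hh : 0 ≤ h)
    (hDh : D * (1 + h ^ 2) ≤ 1 / 16) :
    π * stableDensity (2 - D) β x = (∫ s in (0 : ℝ)..h, (FC D (bb D β) x ⟨0, -s⟩).im) +
        (∫ u in Ioi (0 : ℝ), FC D (bb D β) x ⟨u, -h⟩).re ∧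
    π * fX (2 - D) β x = -(∫ s in (0 : ℝ)..h, s * (FC D (bb D β) x ⟨0, -s⟩).im) +
        (∫ u in Ioi (0 : ℝ), -Complex.I * (⟨u, -h⟩ : ℂ) * FC D (bb D β) x ⟨u, -h⟩).re := by
  have hD1 : D ≤ 1 / 16 := by nlinarith [mul_nonneg hD0.le (sq_nonneg h)]
  have hb := tan_bound hD0 hD1 hβ
  have hpi := Real.pi_pos
  have hcF : ContinuousOn (FC D (bb D β) x) {z | 0 ≤ z.re ∧ z.im ≤ 0} :=
    FC_continuousOn (by linarith)
  have hbd : ∀ u s : ℝ, 0 ≤ u → 0 ≤ s → s ≤ h → _ := fun u s hu hs hsh =>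
    FC_bound_unif hD0 hb hx (h := h) hu hs hsh hDh
  constructor
  · rw [stableDensity_eq]
    have C := contour (Φ := FC D (bb D β) x) (M := 4 * (1 + h) * Real.exp (4 + h ^ 2)) hh hcF
      FC_differentiableOn (fun u s hu hs hsh => ?_)
    · change π * (1 / π * (∫ u in Ioi (0 : ℝ), FC D (bb D β) x ⟨u, 0⟩).re) = _
      rw [C]
      have e := Complex.imCLM.intervalIntegral_comp_comm
        ((vert_cont (b := bb D β) (x := x) hh hD1).intervalIntegrable (μ := volume))
      simp only [Complex.imCLM_apply] at e
      rw [e]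
      simp
    · refine le_trans ?_ (hbd u s hu hs hsh)
      change ‖FC D (bb D β) x ⟨u, -s⟩‖ ≤ _ * ‖FC D (bb D β) x ⟨u, -s⟩‖
      nlinarith [norm_nonneg (⟨u, -s⟩ : ℂ), norm_nonneg (FC D (bb D β) x ⟨u, -s⟩)]
  · have hder : fX (2 - D) β x = _ := (hasDerivAt_stableDensity hD0 hD1 hb x).deriv
    rw [hder]
    have C := contour (Φ := fun z => -Complex.I * z * FC D (bb D β) x z)
      (M := 4 * (1 + h) * Real.exp (4 + h ^ 2)) hh
      ((continuousOn_const.mul continuousOn_id).mul hcF)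
      (((differentiableOn_const _).mul differentiableOn_id).mul FC_differentiableOn)
      (fun u s hu hs hsh => ?_)
    · change π * (1 / π * (∫ u in Ioi (0 : ℝ),
        -Complex.I * (⟨u, 0⟩ : ℂ) * FC D (bb D β) x ⟨u, 0⟩).re) = _
      rw [C]
      have hcont : ContinuousOn
          (fun s : ℝ => -Complex.I * (⟨0, -s⟩ : ℂ) * FC D (bb D β) x ⟨0, -s⟩) (uIcc 0 h) :=
        (continuousOn_const.mul (continuous_mk_right 0).continuousOn).mul (vert_cont hh hD1)
      have e := Complex.imCLM.intervalIntegral_comp_comm (hcont.intervalIntegrable (μ := volume))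
      simp only [Complex.imCLM_apply] at e
      have e2 : ∀ s : ℝ, (-Complex.I * (⟨0, -s⟩ : ℂ) * FC D (bb D β) x ⟨0, -s⟩).im =
          -(s * (FC D (bb D β) x ⟨0, -s⟩).im) := by
        intro s
        have : -Complex.I * (⟨0, -s⟩ : ℂ) = ((-s : ℝ) : ℂ) := by
          apply Complex.ext <;> simp
        rw [this, Complex.im_ofReal_mul]; ring
      simp only [e2, intervalIntegral.integral_neg] at e
      rw [e]
      generalize (∫ s in (0 : ℝ)..h, -Complex.I * (⟨0, -s⟩ : ℂ) * FC D (bb D β) x ⟨0, -s⟩) = J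
      rw [← mul_assoc, mul_one_div_cancel hpi.ne', one_mul, Complex.add_re]
      simp
    · refine le_trans ?_ (hbd u s hu hs hsh)
      change _ ≤ _ * ‖FC D (bb D β) x ⟨u, -s⟩‖
      rw [norm_mul, norm_mul, norm_neg, Complex.norm_I]
      nlinarith [norm_nonneg (⟨u, -s⟩ : ℂ), norm_nonneg (FC D (bb D β) x ⟨u, -s⟩)]

lemma V_nonneg {D β x h : ℝ} (hD0 : 0 < D) (hβ : β ∈ Ioo (-1 : ℝ) 1) (hh : 0 ≤ h)
    (hDh : D * (1 + h ^ 2) ≤ 1 / 16) :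
    0 ≤ (∫ s in (0 : ℝ)..h, (FC D (bb D β) x ⟨0, -s⟩).im) ∧
    0 ≤ (∫ s in (0 : ℝ)..h, s * (FC D (bb D β) x ⟨0, -s⟩).im) := by
  have key : ∀ s ∈ Icc 0 h, 0 ≤ (FC D (bb D β) x ⟨0, -s⟩).im := by
    intro s hs
    have h1 : 0 ≤ s := hs.1
    have h2 : s ≤ h := hs.2
    exact (vert_bounds hD0 hβ hs.1 (le_trans (by gcongr) hDh)).2.1
  exact ⟨intervalIntegral.integral_nonneg hh key,
    intervalIntegral.integral_nonneg hh fun s hs => mul_nonneg hs.1 (key s hs)⟩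

lemma V_lower {D β x h : ℝ} (hD0 : 0 < D) (hβ : β ∈ Ioo (-1 : ℝ) 1) (hx : 1 ≤ x)
    (hxh : 1 / x ≤ h) (hDh : D * (1 + h ^ 2) ≤ 1 / 16) :
    Real.exp (-3) / 6 * (1 + β) * (D * (x ^ (-(2 - D)) / x)) ≤
      ∫ s in (0 : ℝ)..h, (FC D (bb D β) x ⟨0, -s⟩).im := by
  have hx0 : 0 < x := by linarith
  have hx1 : 0 ≤ 1 / x := by positivity
  have hh : 0 ≤ h := hx1.trans hxh
  have hD1 : D ≤ 1 / 16 := by nlinarith [mul_nonneg hD0.le (sq_nonneg h)]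
  have hβ0 : 0 < 1 + β := by linarith [hβ.1]
  have hb := tan_bound hD0 hD1 hβ
  have hsub : (∫ s in (0 : ℝ)..(1 / x), (FC D (bb D β) x ⟨0, -s⟩).im) ≤
      ∫ s in (0 : ℝ)..h, (FC D (bb D β) x ⟨0, -s⟩).im := by
    refine intervalIntegral.integral_mono_interval le_rfl hx1 hxh ?_ (vert_im_int hh hD1)
    filter_upwards [ae_restrict_mem measurableSet_Ioc] with s hs
    have h1 : 0 ≤ s := hs.1.le
    have h2 : s ≤ h := hs.2
    exact (vert_bounds hD0 hβ h1 (le_trans (by gcongr) hDh)).2.1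
  refine le_trans ?_ hsub
  have hlow : (∫ s in (0 : ℝ)..(1 / x), Real.exp (-3) * ((1 + β) * D / 2) * s ^ (2 - D)) ≤
      ∫ s in (0 : ℝ)..(1 / x), (FC D (bb D β) x ⟨0, -s⟩).im := by
    refine intervalIntegral.integral_mono_on hx1 ?_ (vert_im_int hx1 hD1) ?_
    · exact (intervalIntegral.intervalIntegrable_rpow' (by linarith)).const_mul _
    · intro s hs
      have h1 : 0 ≤ s := hs.1
      have h2 : s ≤ 1 / x := hs.2
      have h3 : s ≤ 1 := h2.trans (by rw [div_le_one hx0]; exact hx)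
      have h4 : x * s ≤ 1 := by rw [le_div_iff₀ hx0] at h2; linarith
      have h5 : s ≤ h := h2.trans hxh
      refine le_trans ?_ (vert_bounds hD0 hβ h1 (le_trans (by gcongr) hDh)).1
      rw [mul_assoc]
      have hp0 : 0 ≤ s ^ (2 - D) := Real.rpow_nonneg h1 _
      have hp1 : s ^ (2 - D) ≤ 1 := Real.rpow_le_one h1 h3 (by linarith)
      refine mul_le_mul_of_nonneg_right ?_ (by positivity)
      apply Real.exp_le_exp.mpr
      have hn : ‖psiC D (bb D β) ⟨0, -s⟩‖ ≤ 2 := by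
        unfold psiC
        refine (norm_add_le _ _).trans ?_
        have hz : ‖(⟨0, -s⟩ : ℂ)‖ ≤ s := by simpa using norm_mk_le le_rfl h1
        have hz' : ‖(⟨0, -s⟩ : ℂ)‖ = s := by
          rw [Complex.norm_eq_sqrt_sq_add_sq]; simp [h1]
        have hb' : |bb D β| ≤ 1 / 4 := le_trans hb (by linarith)
        have e1 : ‖1 - Complex.I * (bb D β : ℂ)‖ ≤ 1 + 1 / 4 := by
          refine (norm_sub_le _ _).trans ?_
          rw [norm_mul, Complex.norm_I, one_mul, norm_one, Complex.norm_real, Real.norm_eq_abs]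
          linarith
        have e2 : ‖(⟨0, -s⟩ : ℂ) ^ ((2 - D : ℝ) : ℂ)‖ ≤ 1 := by
          rw [Complex.norm_cpow_real, hz']; exact hp1
        have e3 : ‖Complex.I * (bb D β : ℂ) * (⟨0, -s⟩ : ℂ)‖ ≤ 1 / 4 * 1 := by
          rw [norm_mul, norm_mul, Complex.norm_I, one_mul, Complex.norm_real, Real.norm_eq_abs]
          exact mul_le_mul hb' (hz.trans h3) (norm_nonneg _) (by norm_num)
        have e4 : ‖(⟨0, -s⟩ : ℂ) ^ ((2 - D : ℝ) : ℂ) * (1 - Complex.I * (bb D β : ℂ))‖ ≤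
            1 * (1 + 1 / 4) := by
          rw [norm_mul]
          exact mul_le_mul e2 e1 (norm_nonneg _) (by norm_num)
        linarith
      have := (Complex.re_le_norm (psiC D (bb D β) ⟨0, -s⟩)).trans hn
      linarith
  refine le_trans ?_ hlow
  rw [intervalIntegral.integral_const_mul, integral_rpow (Or.inl (by linarith)),
    Real.zero_rpow (by linarith), sub_zero]
  have e : (1 / x) ^ (2 - D + 1) = x ^ (-(2 - D)) / x := by
    rw [one_div, Real.inv_rpow hx0.le, Real.rpow_add hx0, Real.rpow_one, Real.rpow_neg hx0.le]
    field_simp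
  rw [e]
  have hp : 0 < x ^ (-(2 - D)) / x := div_pos (Real.rpow_pos_of_pos hx0 _) hx0
  set p := x ^ (-(2 - D)) / x
  have e5 : p / 3 ≤ p / (2 - D + 1) := by
    apply div_le_div_of_nonneg_left hp.le <;> linarith
  calc Real.exp (-3) / 6 * (1 + β) * (D * p) = Real.exp (-3) * ((1 + β) * D / 2) * (p / 3) := by ring
    _ ≤ _ := by gcongr

lemma V_upper {D β x h : ℝ} (hD0 : 0 < D) (hβ : β ∈ Ioo (-1 : ℝ) 1) (hx : 0 < x) (hh : 0 ≤ h)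
    (hxh : h ≤ x / 2) (hDh : D * (1 + h ^ 2) ≤ 1 / 16) :
    (∫ s in (0 : ℝ)..h, (FC D (bb D β) x ⟨0, -s⟩).im) ≤
      12320 * Real.exp 4 * (D * (x ^ (-(2 - D)) / x)) ∧
    x * (∫ s in (0 : ℝ)..h, s * (FC D (bb D β) x ⟨0, -s⟩).im) ≤
      12320 * Real.exp 4 * (D * (x ^ (-(2 - D)) / x)) := by
  have hD1 : D ≤ 1 / 16 := by nlinarith [mul_nonneg hD0.le (sq_nonneg h)]
  have hp : 0 < x ^ (-(2 - D)) := Real.rpow_pos_of_pos hx _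
  have key : ∀ s ∈ Icc 0 h, (1 + x * s) * (FC D (bb D β) x ⟨0, -s⟩).im ≤
      3080 * Real.exp 4 * D * x ^ (-(2 - D)) * Real.exp (-(x / 4) * s) := by
    intro s hs
    have h1 : 0 ≤ s := hs.1
    have h2 : s ≤ h := hs.2
    have hb := (vert_bounds (x := x) hD0 hβ h1 (le_trans (by gcongr) hDh)).2.2
    have hy : 0 ≤ x * s := by positivity
    have e1 : Real.exp (4 + s ^ 2 - x * s) ≤ Real.exp 4 * Real.exp (-(x * s) / 2) := by
      rw [← Real.exp_add]; apply Real.exp_le_exp.mpr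
      nlinarith
    have e2 : s ^ (2 - D) = x ^ (-(2 - D)) * (x * s) ^ (2 - D) := by
      rw [Real.mul_rpow hx.le h1, ← mul_assoc, ← Real.rpow_add hx, neg_add_cancel, Real.rpow_zero,
        one_mul]
    set y := x * s with hyd
    have e3 : (1 + y) * y ^ (2 - D) ≤ 770 * Real.exp (y / 4) := by
      have hc := cube_le_exp hy
      have hE : 1 ≤ Real.exp (y / 4) := Real.one_le_exp (by positivity)
      rcases le_or_gt 1 y with h' | h'
      · have : y ^ (2 - D) ≤ y ^ (2 : ℝ) := Real.rpow_le_rpow_of_exponent_le h' (by linarith)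
        rw [Real.rpow_two] at this
        calc (1 + y) * y ^ (2 - D) ≤ (y + y) * y ^ 2 := by gcongr
          _ = 2 * y ^ 3 := by ring
          _ ≤ _ := by linarith
      · have : y ^ (2 - D) ≤ 1 := Real.rpow_le_one hy h'.le (by linarith)
        have h0 : 0 ≤ y ^ (2 - D) := Real.rpow_nonneg hy _
        nlinarith
    calc (1 + y) * (FC D (bb D β) x ⟨0, -s⟩).im
        ≤ (1 + y) * (Real.exp 4 * Real.exp (-y / 2) * (4 * D * (x ^ (-(2 - D)) * y ^ (2 - D)))) := by
          rw [← e2]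
          refine mul_le_mul_of_nonneg_left (hb.trans ?_) (by positivity)
          have : 0 ≤ s ^ (2 - D) := Real.rpow_nonneg h1 _
          exact mul_le_mul_of_nonneg_right e1 (by positivity)
      _ = 4 * Real.exp 4 * D * x ^ (-(2 - D)) * Real.exp (-y / 2) * ((1 + y) * y ^ (2 - D)) := by ring
      _ ≤ 4 * Real.exp 4 * D * x ^ (-(2 - D)) * Real.exp (-y / 2) * (770 * Real.exp (y / 4)) :=
          mul_le_mul_of_nonneg_left e3 (by positivity)
      _ = 3080 * Real.exp 4 * D * x ^ (-(2 - D)) * (Real.exp (-y / 2) * Real.exp (y / 4)) := by ring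
      _ = _ := by
          rw [← Real.exp_add]; congr 2; rw [hyd]; ring
  have hIntg : (∫ s in (0 : ℝ)..h, 3080 * Real.exp 4 * D * x ^ (-(2 - D)) * Real.exp (-(x / 4) * s)) ≤
      12320 * Real.exp 4 * (D * (x ^ (-(2 - D)) / x)) := by
    rw [intervalIntegral.integral_const_mul]
    have hi := integrableOn_exp_mul_Ioi (a := -(x / 4)) (by linarith) 0
    have : (∫ s in (0 : ℝ)..h, Real.exp (-(x / 4) * s)) ≤ 4 / x := by
      rw [intervalIntegral.integral_of_le hh]
      refine (setIntegral_mono_set hi (Filter.Eventually.of_forall fun s => (Real.exp_pos _).le)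
        (Ioc_subset_Ioi_self.eventuallyLE)).trans ?_
      rw [integral_exp_mul_Ioi (by linarith)]
      simp
    calc _ ≤ 3080 * Real.exp 4 * D * x ^ (-(2 - D)) * (4 / x) := by gcongr
      _ = _ := by ring
  have hci : IntervalIntegrable
      (fun s : ℝ => 3080 * Real.exp 4 * D * x ^ (-(2 - D)) * Real.exp (-(x / 4) * s)) volume 0 h :=
    Continuous.intervalIntegrable (by fun_prop) _ _
  have hnn : ∀ s ∈ Icc 0 h, 0 ≤ (FC D (bb D β) x ⟨0, -s⟩).im := by
    intro s hs
    have h1 : 0 ≤ s := hs.1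
    have h2 : s ≤ h := hs.2
    exact (vert_bounds hD0 hβ hs.1 (le_trans (by gcongr) hDh)).2.1
  constructor
  · refine le_trans ?_ hIntg
    refine intervalIntegral.integral_mono_on hh (vert_im_int hh hD1) hci fun s hs => ?_
    have := key s hs
    have h0 := hnn s hs
    have : 0 ≤ x * s := mul_nonneg hx.le hs.1
    nlinarith
  · refine le_trans ?_ hIntg
    rw [← intervalIntegral.integral_const_mul]
    refine intervalIntegral.integral_mono_on hh ((vert_im_int' hh hD1).const_mul x) hci fun s hs => ?_
    have := key s hs
    have h0 := hnn s hs
    nlinarith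

lemma V_small {D β x h : ℝ} (hD0 : 0 < D) (hβ : β ∈ Ioo (-1 : ℝ) 1) (hx : 0 ≤ x) (hh : 0 ≤ h)
    (hDh : D * (1 + h ^ 2) ≤ 1 / 16) :
    (∫ s in (0 : ℝ)..h, (FC D (bb D β) x ⟨0, -s⟩).im) ≤
      D * (4 * Real.exp (4 + h ^ 2) * (1 + h ^ 2) * (1 + h) * h) ∧
    (∫ s in (0 : ℝ)..h, s * (FC D (bb D β) x ⟨0, -s⟩).im) ≤
      D * (4 * Real.exp (4 + h ^ 2) * (1 + h ^ 2) * (1 + h) * h) := by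
  have hD1 : D ≤ 1 / 16 := by nlinarith [mul_nonneg hD0.le (sq_nonneg h)]
  have hnn : ∀ s ∈ Icc 0 h, 0 ≤ (FC D (bb D β) x ⟨0, -s⟩).im := by
    intro s hs
    have h1 : 0 ≤ s := hs.1
    have h2 : s ≤ h := hs.2
    exact (vert_bounds hD0 hβ hs.1 (le_trans (by gcongr) hDh)).2.1
  have key : ∀ s ∈ Icc 0 h, (1 + s) * (FC D (bb D β) x ⟨0, -s⟩).im ≤
      D * (4 * Real.exp (4 + h ^ 2) * (1 + h ^ 2) * (1 + h)) := by
    intro s hs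
    have h1 : 0 ≤ s := hs.1
    have h2 : s ≤ h := hs.2
    have hs2 : s ^ 2 ≤ h ^ 2 := by gcongr
    have hb := (vert_bounds (x := x) hD0 hβ h1 (le_trans (by gcongr) hDh)).2.2
    have e0 := rpow_le_one_add_sq hD0 hD1 h1
    have e1 : Real.exp (4 + s ^ 2 - x * s) ≤ Real.exp (4 + h ^ 2) := by
      apply Real.exp_le_exp.mpr
      nlinarith [mul_nonneg hx h1]
    calc (1 + s) * (FC D (bb D β) x ⟨0, -s⟩).im
        ≤ (1 + h) * (Real.exp (4 + h ^ 2) * (4 * D * (1 + h ^ 2))) := by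
          refine mul_le_mul (by linarith) (hb.trans ?_) (hnn s hs) (by positivity)
          have : 0 ≤ s ^ (2 - D) := Real.rpow_nonneg h1 _
          refine mul_le_mul e1 ?_ (by positivity) (by positivity)
          refine mul_le_mul_of_nonneg_left (by linarith) (by positivity)
      _ = _ := by ring
  have hc : (∫ s in (0 : ℝ)..h, D * (4 * Real.exp (4 + h ^ 2) * (1 + h ^ 2) * (1 + h))) =
      D * (4 * Real.exp (4 + h ^ 2) * (1 + h ^ 2) * (1 + h) * h) := by
    rw [intervalIntegral.integral_const, smul_eq_mul]; ring
  rw [← hc]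
  constructor
  · refine intervalIntegral.integral_mono_on hh (vert_im_int hh hD1) (by simp) fun s hs => ?_
    nlinarith [key s hs, hnn s hs, mul_nonneg hs.1 (hnn s hs)]
  · refine intervalIntegral.integral_mono_on hh (vert_im_int' hh hD1) (by simp) fun s hs => ?_
    nlinarith [key s hs, hnn s hs, mul_nonneg hs.1 (hnn s hs)]

lemma norm_integral_le_quarter {f : ℝ → ℂ} {M : ℝ}
    (hb : ∀ u, 0 ≤ u → ‖f u‖ ≤ M * Real.exp (-u / 4)) :
    ‖∫ u in Ioi (0 : ℝ), f u‖ ≤ 4 * M := by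
  have h := norm_integral_le_of_norm_le (μ := volume.restrict (Ioi (0 : ℝ))) (f := f)
    (g := fun u => M * Real.exp (-u / 4)) (integrableOn_exp_quarter.const_mul M) ?_
  · rw [integral_const_mul, integral_exp_quarter] at h
    linarith
  · filter_upwards [ae_restrict_mem measurableSet_Ioi] with u hu
    exact hb u (le_of_lt hu)

lemma H_crude {D b x h : ℝ} (hD0 : 0 < D) (hb : |b| ≤ 4 * D) (hh : 0 ≤ h)
    (hDh : D * (1 + h ^ 2) ≤ 1 / 16) :
    |(∫ u in Ioi (0 : ℝ), FC D b x ⟨u, -h⟩).re| ≤ 16 * (1 + h) * Real.exp (4 + h ^ 2 - x * h) ∧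
    |(∫ u in Ioi (0 : ℝ), -Complex.I * (⟨u, -h⟩ : ℂ) * FC D b x ⟨u, -h⟩).re| ≤
      16 * (1 + h) * Real.exp (4 + h ^ 2 - x * h) := by
  constructor
  · refine (Complex.abs_re_le_norm _).trans ((norm_integral_le_quarter
      (M := 4 * (1 + h) * Real.exp (4 + h ^ 2 - x * h)) fun u hu => ?_).trans (by linarith))
    refine le_trans ?_ (FC_bound' hD0 hb x hu hh hDh)
    nlinarith [norm_nonneg (⟨u, -h⟩ : ℂ), norm_nonneg (FC D b x ⟨u, -h⟩)]
  · refine (Complex.abs_re_le_norm _).trans ((norm_integral_le_quarter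
      (M := 4 * (1 + h) * Real.exp (4 + h ^ 2 - x * h)) fun u hu => ?_).trans (by linarith))
    refine le_trans ?_ (FC_bound' hD0 hb x hu hh hDh)
    rw [norm_mul, norm_mul, norm_neg, Complex.norm_I]
    nlinarith [norm_nonneg (⟨u, -h⟩ : ℂ), norm_nonneg (FC D b x ⟨u, -h⟩)]

/-- numerical constant in the comparison with the Gaussian integrand -/
noncomputable def KK : ℝ := 44 * 24584 * Real.exp 4

lemma KK_pos : 0 < KK := by unfold KK; positivity

lemma poly_exp {u : ℝ} (hu : 0 ≤ u) :
    (1 + u) * (1 + u ^ 3) * Real.exp (-u / 2) ≤ 24584 * Real.exp (-u / 4) := by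
  have h1 : 1 + u ≤ 8 * Real.exp (u / 8) := by linarith [Real.add_one_le_exp (u / 8)]
  have h2 : 1 + u ^ 3 ≤ 3073 * Real.exp (u / 8) := by
    have := cube_le_exp (y := u / 2) (by positivity)
    have e : u / 2 / 4 = u / 8 := by ring
    rw [e] at this
    have hE : 1 ≤ Real.exp (u / 8) := Real.one_le_exp (by positivity)
    nlinarith
  calc (1 + u) * (1 + u ^ 3) * Real.exp (-u / 2)
      ≤ (8 * Real.exp (u / 8)) * (3073 * Real.exp (u / 8)) * Real.exp (-u / 2) := by gcongr
    _ = 24584 * (Real.exp (u / 8) * Real.exp (u / 8) * Real.exp (-u / 2)) := by ring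
    _ = _ := by rw [← Real.exp_add, ← Real.exp_add]; congr 2; ring

lemma FC_sub_gauss {D b x u : ℝ} (hD0 : 0 < D) (hb : |b| ≤ 4 * D) (hx : 0 ≤ x) (hu : 0 ≤ u)
    (hDh : D * (1 + (x / 2) ^ 2) ≤ 1 / 16) :
    (1 + u) * ‖FC D b x ⟨u, -(x / 2)⟩ - ((Real.exp (-(x ^ 2) / 4) * Real.exp (-u ^ 2) : ℝ) : ℂ)‖ ≤
      KK * (D * (1 + (x / 2) ^ 3)) * Real.exp (-(x ^ 2) / 4) * Real.exp (-u / 4) := by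
  set h := x / 2 with hhd
  have hh : 0 ≤ h := by positivity
  have hD1 : D ≤ 1 / 16 := by nlinarith [mul_nonneg hD0.le (sq_nonneg h)]
  set z : ℂ := ⟨u, -h⟩ with hz
  have zre : z.re = u := rfl
  have zim : z.im = -h := rfl
  have hg : ((Real.exp (-(x ^ 2) / 4) * Real.exp (-u ^ 2) : ℝ) : ℂ) =
      Complex.exp (-(Complex.I * z * (x : ℂ)) - z ^ 2) := by
    rw [← Real.exp_add, Complex.ofReal_exp]
    congr 1
    have hxh : x = 2 * h := by rw [hhd]; ring
    apply Complex.ext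
    · rw [Complex.ofReal_re]; simp [pow_two, zre, zim]; rw [hxh]; ring
    · rw [Complex.ofReal_im]; simp [pow_two, zre, zim]; rw [hxh]; ring
  rw [hg, FC]
  have hre1 : (-(Complex.I * z * (x : ℂ)) - psiC D b z).re ≤ 4 - x ^ 2 / 4 - u / 2 := by
    have := psi_re_lower hD0 hb hu hh hDh
    have e : (-(Complex.I * z * (x : ℂ)) - psiC D b z).re = -(x * h) - (psiC D b z).re := by
      simp [zre, zim]; ring
    rw [e]
    have e2 : x * h - h ^ 2 = x ^ 2 / 4 := by rw [hhd]; ring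
    linarith
  have hre2 : (-(Complex.I * z * (x : ℂ)) - z ^ 2).re ≤ 4 - x ^ 2 / 4 - u / 2 := by
    have e : (-(Complex.I * z * (x : ℂ)) - z ^ 2).re = -(x * h) - (u ^ 2 - h ^ 2) := by
      simp [pow_two, zre, zim]; ring
    rw [e]
    have e2 : x * h - h ^ 2 = x ^ 2 / 4 := by rw [hhd]; ring
    nlinarith [sq_nonneg (u - 1)]
  have k := norm_exp_sub_exp_le hre1 hre2
  have e3 : ‖-(Complex.I * z * (x : ℂ)) - psiC D b z - (-(Complex.I * z * (x : ℂ)) - z ^ 2)‖ ≤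
      11 * D * (4 * ((1 + h ^ 3) * (1 + u ^ 3))) := by
    have : -(Complex.I * z * (x : ℂ)) - psiC D b z - (-(Complex.I * z * (x : ℂ)) - z ^ 2) =
        -(psiC D b z - z ^ 2) := by ring
    rw [this, norm_neg]
    refine (psi_sub_sq hD0 (by linarith) hb (by rw [zre]; exact hu)
      (by rw [zim]; linarith)).trans ?_
    gcongr
    have h1 : ‖z‖ ≤ u + h := norm_mk_le hu hh
    have h2 : ‖z‖ ^ 3 ≤ (u + h) ^ 3 := by gcongr
    have h3 : (u + h) ^ 3 ≤ 4 * (u ^ 3 + h ^ 3) := by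
      nlinarith [mul_nonneg (add_nonneg hu hh) (sq_nonneg (u - h))]
    nlinarith [mul_nonneg (pow_nonneg hu 3) (pow_nonneg hh 3), pow_nonneg hu 3, pow_nonneg hh 3]
  have e4 : Real.exp (4 - x ^ 2 / 4 - u / 2) =
      Real.exp 4 * Real.exp (-(x ^ 2) / 4) * Real.exp (-u / 2) := by
    rw [← Real.exp_add, ← Real.exp_add]; congr 1; ring
  calc (1 + u) * ‖_‖ ≤ (1 + u) * (Real.exp 4 * Real.exp (-(x ^ 2) / 4) * Real.exp (-u / 2) *
        (11 * D * (4 * ((1 + h ^ 3) * (1 + u ^ 3))))) := by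
        rw [← e4]
        refine mul_le_mul_of_nonneg_left (k.trans ?_) (by positivity)
        exact mul_le_mul_of_nonneg_left e3 (Real.exp_nonneg _)
    _ = 44 * Real.exp 4 * Real.exp (-(x ^ 2) / 4) * (D * (1 + h ^ 3)) *
        ((1 + u) * (1 + u ^ 3) * Real.exp (-u / 2)) := by ring
    _ ≤ 44 * Real.exp 4 * Real.exp (-(x ^ 2) / 4) * (D * (1 + h ^ 3)) *
        (24584 * Real.exp (-u / 4)) :=
        mul_le_mul_of_nonneg_left (poly_exp hu) (by positivity)
    _ = _ := by unfold KK; ring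

lemma H_gauss {D b x : ℝ} (hD0 : 0 < D) (hb : |b| ≤ 4 * D) (hx : 0 ≤ x)
    (hDh : D * (1 + (x / 2) ^ 2) ≤ 1 / 16) :
    |(∫ u in Ioi (0 : ℝ), FC D b x ⟨u, -(x / 2)⟩).re - Real.exp (-(x ^ 2) / 4) * (√π / 2)| ≤
      4 * KK * (D * (1 + (x / 2) ^ 3)) * Real.exp (-(x ^ 2) / 4) ∧
    |(∫ u in Ioi (0 : ℝ), -Complex.I * (⟨u, -(x / 2)⟩ : ℂ) * FC D b x ⟨u, -(x / 2)⟩).re -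
        (-(x / 2)) * (Real.exp (-(x ^ 2) / 4) * (√π / 2))| ≤
      4 * KK * (D * (1 + (x / 2) ^ 3)) * Real.exp (-(x ^ 2) / 4) * (1 + x / 2) := by
  set h := x / 2 with hhd
  have hh : 0 ≤ h := by positivity
  have hD1 : D ≤ 1 / 16 := by nlinarith [mul_nonneg hD0.le (sq_nonneg h)]
  set G : ℝ := Real.exp (-(x ^ 2) / 4) with hG
  have hK := KK_pos
  have hgi : IntegrableOn (fun u : ℝ => Real.exp (-u ^ 2)) (Ioi 0) := by
    have := (integrable_exp_neg_mul_sq (b := 1) (by norm_num)).integrableOn (s := Ioi (0 : ℝ))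
    simpa using this
  have hgI : ∫ u in Ioi (0 : ℝ), Real.exp (-u ^ 2) = √π / 2 := by
    have := integral_gaussian_Ioi 1
    simpa using this
  have hgui : IntegrableOn (fun u : ℝ => u * Real.exp (-u ^ 2)) (Ioi 0) := by
    have := (integrable_mul_exp_neg_mul_sq (b := 1) (by norm_num)).integrableOn (s := Ioi (0 : ℝ))
    simpa using this
  have hFc : ContinuousOn (FC D b x) {z | 0 ≤ z.re ∧ z.im ≤ 0} := FC_continuousOn (by linarith)
  have hnorm : ∀ u : ℝ, 0 ≤ u → ‖(⟨u, -h⟩ : ℂ)‖ ≤ (1 + u) * (1 + h) := fun u hu =>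
    (norm_mk_le hu hh).trans (by nlinarith [mul_nonneg hu hh])
  constructor
  · have iF : IntegrableOn (fun u : ℝ => FC D b x ⟨u, -h⟩) (Ioi 0) := by
      refine quad_integrable (M := 4 * (1 + h) * Real.exp (4 + h ^ 2 - x * h)) hh hFc fun u hu => ?_
      refine le_trans ?_ (FC_bound' hD0 hb x hu hh hDh)
      nlinarith [norm_nonneg (⟨u, -h⟩ : ℂ), norm_nonneg (FC D b x ⟨u, -h⟩)]
    have iG : IntegrableOn (fun u : ℝ => ((G * Real.exp (-u ^ 2) : ℝ) : ℂ)) (Ioi 0) :=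
      (hgi.const_mul G).ofReal
    have hI : (∫ u in Ioi (0 : ℝ), ((G * Real.exp (-u ^ 2) : ℝ) : ℂ)).re = G * (√π / 2) := by
      rw [integral_complex_ofReal, Complex.ofReal_re, integral_const_mul, hgI]
    rw [← hI, ← Complex.sub_re, ← integral_sub iF iG]
    refine (Complex.abs_re_le_norm _).trans ((norm_integral_le_quarter
      (M := KK * (D * (1 + h ^ 3)) * G) fun u hu => ?_).trans (by linarith))
    refine le_trans ?_ (FC_sub_gauss hD0 hb hx hu hDh)
    nlinarith [norm_nonneg (FC D b x ⟨u, -h⟩ - ((G * Real.exp (-u ^ 2) : ℝ) : ℂ))]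
  · have iF : IntegrableOn (fun u : ℝ => -Complex.I * (⟨u, -h⟩ : ℂ) * FC D b x ⟨u, -h⟩) (Ioi 0) := by
      refine quad_integrable (Φ := fun z => -Complex.I * z * FC D b x z)
        (M := 4 * (1 + h) * Real.exp (4 + h ^ 2 - x * h)) hh
        ((continuousOn_const.mul continuousOn_id).mul hFc) fun u hu => ?_
      refine le_trans ?_ (FC_bound' hD0 hb x hu hh hDh)
      rw [norm_mul, norm_mul, norm_neg, Complex.norm_I]
      nlinarith [norm_nonneg (⟨u, -h⟩ : ℂ), norm_nonneg (FC D b x ⟨u, -h⟩)]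
    have hpt : ∀ u : ℝ, -Complex.I * (⟨u, -h⟩ : ℂ) * ((G * Real.exp (-u ^ 2) : ℝ) : ℂ) =
        ((-h * (G * Real.exp (-u ^ 2)) : ℝ) : ℂ) +
          ((-G * (u * Real.exp (-u ^ 2)) : ℝ) : ℂ) * Complex.I := by
      intro u
      rw [Complex.mk_eq_add_mul_I]
      push_cast
      linear_combination (-(h : ℂ)) * ((G : ℂ) * Complex.exp (-(u : ℂ) ^ 2)) *
        (-1 : ℂ) * Complex.I_sq
    have i1 : IntegrableOn (fun u : ℝ => ((-h * (G * Real.exp (-u ^ 2)) : ℝ) : ℂ)) (Ioi 0) :=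
      ((hgi.const_mul G).const_mul (-h)).ofReal
    have i2 : IntegrableOn (fun u : ℝ => ((-G * (u * Real.exp (-u ^ 2)) : ℝ) : ℂ) * Complex.I)
        (Ioi 0) := (hgui.const_mul (-G)).ofReal.mul_const _
    have iG : IntegrableOn (fun u : ℝ => -Complex.I * (⟨u, -h⟩ : ℂ) *
        ((G * Real.exp (-u ^ 2) : ℝ) : ℂ)) (Ioi 0) := by
      simp only [hpt]
      exact i1.add i2
    have hI : (∫ u in Ioi (0 : ℝ), -Complex.I * (⟨u, -h⟩ : ℂ) *
        ((G * Real.exp (-u ^ 2) : ℝ) : ℂ)).re = -h * (G * (√π / 2)) := by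
      simp only [hpt]
      rw [integral_add i1 i2, integral_mul_const, integral_complex_ofReal,
        integral_complex_ofReal, Complex.add_re, Complex.ofReal_re, integral_const_mul,
        integral_const_mul, hgI, Complex.re_ofReal_mul, Complex.I_re]
      ring
    rw [← hI, ← Complex.sub_re, ← integral_sub iF iG]
    refine (Complex.abs_re_le_norm _).trans ((norm_integral_le_quarter
      (M := KK * (D * (1 + h ^ 3)) * G * (1 + h)) fun u hu => ?_).trans (by linarith))
    rw [← mul_sub, norm_mul, norm_mul, norm_neg, Complex.norm_I, one_mul]
    have k := FC_sub_gauss hD0 hb hx hu hDh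
    calc _ ≤ (1 + u) * (1 + h) * ‖FC D b x ⟨u, -h⟩ - ((G * Real.exp (-u ^ 2) : ℝ) : ℂ)‖ :=
          mul_le_mul_of_nonneg_right (hnorm u hu) (norm_nonneg _)
      _ = (1 + h) * ((1 + u) * ‖FC D b x ⟨u, -h⟩ - ((G * Real.exp (-u ^ 2) : ℝ) : ℂ)‖) := by ring
      _ ≤ (1 + h) * (KK * (D * (1 + h ^ 3)) * G * Real.exp (-u / 4)) :=
          mul_le_mul_of_nonneg_left k (by positivity)
      _ = _ := by ring


/-- The two-term envelope property used for domination. -/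
def Env (c C F F1 x : ℝ) : Prop :=
  ∃ g P : ℝ, 0 ≤ g ∧ 0 ≤ P ∧ g ≤ Real.exp (-(x ^ 2) / 4) ∧ P ≤ 2 / (1 + x ^ 2) ∧
    c * (g + P) ≤ F ∧ F ≤ C * (g + P) ∧ |x * F1| ≤ C * ((1 + x) ^ 2 * g + P)

lemma sqrt_pi_half : 7 / 8 ≤ √π / 2 ∧ √π / 2 ≤ 1 := by
  constructor
  · have : (7 / 4 : ℝ) ≤ √π := by
      apply Real.le_sqrt_of_sq_le; nlinarith [Real.pi_gt_d2]
    linarith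
  · have : √π ≤ 2 := by
      rw [Real.sqrt_le_left (by norm_num)]; nlinarith [Real.pi_le_four]
    linarith

lemma P_bounds {D x : ℝ} (hD0 : 0 < D) (hD1 : D ≤ 1 / 16) (hx : 1 ≤ x) :
    0 ≤ D * (x ^ (-(2 - D)) / x) ∧ D * (x ^ (-(2 - D)) / x) ≤ 2 / (1 + x ^ 2) ∧
    D * (x ^ 3)⁻¹ ≤ D * (x ^ (-(2 - D)) / x) := by
  have hx0 : 0 < x := by linarith
  have hp : 0 < x ^ (-(2 - D)) := Real.rpow_pos_of_pos hx0 _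
  refine ⟨by positivity, ?_, ?_⟩
  · have h1 : x ^ (-(2 - D)) ≤ x ^ (-1 : ℝ) :=
      Real.rpow_le_rpow_of_exponent_le hx (by linarith)
    rw [Real.rpow_neg_one] at h1
    have h2 : x ^ (-(2 - D)) / x ≤ x⁻¹ / x := by gcongr
    have h3 : x⁻¹ / x = 1 / x ^ 2 := by field_simp
    have h4 : 1 / x ^ 2 ≤ 2 / (1 + x ^ 2) := by
      rw [div_le_div_iff₀ (by positivity) (by positivity)]; nlinarith
    have h5 : 0 ≤ x ^ (-(2 - D)) / x := by positivity
    nlinarith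
  · have h1 : x ^ (-2 : ℝ) ≤ x ^ (-(2 - D)) :=
      Real.rpow_le_rpow_of_exponent_le hx (by linarith)
    have h2 : x ^ (-2 : ℝ) = (x ^ 2)⁻¹ := by
      rw [Real.rpow_neg hx0.le]; norm_num
    have h3 : (x ^ 3)⁻¹ = (x ^ 2)⁻¹ / x := by field_simp
    rw [h3, ← h2]
    gcongr

/-- Smallness in the central region. -/
lemma small_A {N D x : ℝ} (hN : 64 ≤ N) (hN2 : 32 * KK ≤ N) (hD0 : 0 < D) (hD : D * (2 * N ^ 4) ≤ 1)
    (hx : 0 ≤ x) (hDx : D * x ^ 4 ≤ 1) :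
    4 * KK * (D * (1 + (x / 2) ^ 3)) ≤ 1 / 4 ∧ D * (1 + (x / 2) ^ 2) ≤ 1 / 16 := by
  have hK := KK_pos
  have hNp : 0 < N := by linarith
  have h1 : D * x ^ 3 ≤ D * N ^ 3 + 1 / N := by
    rcases le_total x N with h | h
    · have : D * x ^ 3 ≤ D * N ^ 3 := by gcongr
      have : 0 ≤ 1 / N := by positivity
      linarith
    · have : D * x ^ 3 ≤ 1 / N := by
        rw [le_div_iff₀ hNp]
        calc D * x ^ 3 * N ≤ D * x ^ 3 * x := by gcongr
          _ = D * x ^ 4 := by ring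
          _ ≤ 1 := hDx
      have : 0 ≤ D * N ^ 3 := by positivity
      linarith
  have h2 : D * N ^ 3 ≤ 1 / (2 * N) := by
    rw [le_div_iff₀ (by positivity)]; nlinarith
  have h3 : D ≤ 1 / (2 * N) := by
    refine le_trans ?_ h2
    have : 1 ≤ N ^ 3 := one_le_pow₀ (by linarith)
    nlinarith
  have e : 1 / (2 * N) = 1 / N / 2 := by field_simp
  have hx3 : 0 ≤ D * x ^ 3 := by positivity
  have h4 : D * (1 + (x / 2) ^ 3) ≤ 2 * (1 / N) := by
    have : D * (1 + (x / 2) ^ 3) = D + D * x ^ 3 / 8 := by ring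
    rw [this]; linarith
  have h5 : 1 / N ≤ 1 / 64 := one_div_le_one_div_of_le (by norm_num) hN
  constructor
  · have : KK * (1 / N) ≤ 1 / 32 := by
      rw [mul_one_div, div_le_iff₀ hNp]; linarith
    nlinarith
  · have h6 : (x / 2) ^ 2 ≤ 1 + (x / 2) ^ 3 := by
      have h0 : 0 ≤ x / 2 := by positivity
      nlinarith [sq_nonneg (x / 2 - 1), mul_nonneg h0 (sq_nonneg (x / 2 - 1))]
    have : D * (1 + (x / 2) ^ 2) ≤ D + D * (1 + (x / 2) ^ 3) := by nlinarith
    linarith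

noncomputable def c1 (β : ℝ) : ℝ := Real.exp (-3) / 6 * (1 + β)
noncomputable def CC : ℝ := 12320 * Real.exp 4 + 32 * Real.exp 6 + 2

set_option maxHeartbeats 1600000 in
lemma env_A {D β x : ℝ} (hD0 : 0 < D) (hβ : β ∈ Ioo (-1 : ℝ) 1) (hx : 0 ≤ x)
    (hs : 4 * KK * (D * (1 + (x / 2) ^ 3)) ≤ 1 / 4) (hDh : D * (1 + (x / 2) ^ 2) ≤ 1 / 16) :
    Env (min (1 / 2) (c1 β / 2)) CC (π * stableDensity (2 - D) β x) (π * fX (2 - D) β x) x := by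
  have hD1 : D ≤ 1 / 16 := by nlinarith [mul_nonneg hD0.le (sq_nonneg (x / 2))]
  have hb : |bb D β| ≤ 4 * D := tan_bound hD0 hD1 hβ
  have hh : 0 ≤ x / 2 := by positivity
  have hc1 : 0 < c1 β := by unfold c1; have : 0 < 1 + β := by linarith [hβ.1]
                            positivity
  obtain ⟨e1, e2⟩ := decomp hD0 hβ hx hh hDh
  obtain ⟨n1, n2⟩ := V_nonneg (x := x) hD0 hβ hh hDh
  obtain ⟨g1, g2⟩ := H_gauss hD0 hb hx hDh
  rw [e1, e2]
  set G := Real.exp (-(x ^ 2) / 4) with hG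
  have hGp : 0 < G := Real.exp_pos _
  set V := ∫ s in (0 : ℝ)..(x / 2), (FC D (bb D β) x ⟨0, -s⟩).im with hV
  set V1 := ∫ s in (0 : ℝ)..(x / 2), s * (FC D (bb D β) x ⟨0, -s⟩).im with hV1
  set H := (∫ u in Ioi (0 : ℝ), FC D (bb D β) x ⟨u, -(x / 2)⟩).re
  set H1 := (∫ u in Ioi (0 : ℝ), -Complex.I * (⟨u, -(x / 2)⟩ : ℂ) *
    FC D (bb D β) x ⟨u, -(x / 2)⟩).re
  obtain ⟨s1, s2⟩ := sqrt_pi_half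
  set η := 4 * KK * (D * (1 + (x / 2) ^ 3))
  have hη : η * G ≤ 1 / 4 * G := by gcongr
  have g1' := abs_le.1 (g1.trans hη)
  have a1 : G * (7 / 8) ≤ G * (√π / 2) := by gcongr
  have a2 : G * (√π / 2) ≤ G * 1 := by gcongr
  have hHl : G / 2 ≤ H := by linarith [g1'.1]
  have hHu : H ≤ 2 * G := by linarith [g1'.2]
  have g2' : |H1 - (-(x / 2)) * (G * (√π / 2))| ≤ 1 / 4 * G * (1 + x / 2) :=
    g2.trans (by gcongr)
  have hH1 : |H1| ≤ 2 * G * (1 + x) := by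
    have g3 := abs_le.1 g2'
    have a3 : x / 2 * (G * (√π / 2)) ≤ x / 2 * G := by
      apply mul_le_mul_of_nonneg_left _ hh; linarith
    have a4 : 0 ≤ x / 2 * (G * (√π / 2)) := by positivity
    have a5 : 0 ≤ G * x := by positivity
    rw [abs_le]; constructor
    · linarith [g3.1]
    · linarith [g3.2]
  have hxH1 : x * |H1| ≤ 2 * ((1 + x) ^ 2 * G) := by
    calc x * |H1| ≤ (1 + x) * (2 * G * (1 + x)) := by gcongr; linarith
      _ = _ := by ring
  have hxF : |x * (-V1 + H1)| ≤ x * V1 + x * |H1| := by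
    rw [abs_mul, abs_of_nonneg hx, ← mul_add]
    refine mul_le_mul_of_nonneg_left ?_ hx
    refine (abs_add_le _ _).trans ?_
    rw [abs_neg, abs_of_nonneg n2]
  have hm1 : min (1 / 2) (c1 β / 2) ≤ 1 / 2 := min_le_left _ _
  have hm2 : min (1 / 2) (c1 β / 2) ≤ c1 β / 2 := min_le_right _ _
  have he4 := Real.exp_pos 4
  have he6 := Real.exp_pos 6
  rcases le_total 2 x with h2 | h2
  · obtain ⟨p0, p1, -⟩ := P_bounds hD0 hD1 (by linarith : 1 ≤ x)
    have vl := V_lower (x := x) (h := x / 2) hD0 hβ (by linarith)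
      (by rw [div_le_div_iff₀ (by linarith) (by norm_num)]; nlinarith) hDh
    obtain ⟨u1, u2⟩ := V_upper (x := x) (h := x / 2) hD0 hβ (by linarith) hh le_rfl hDh
    rw [← hV] at vl u1
    rw [← hV1] at u2
    change c1 β * _ ≤ V at vl
    refine ⟨G, D * (x ^ (-(2 - D)) / x), hGp.le, p0, le_rfl, p1, ?_, ?_, ?_⟩
    all_goals set P := D * (x ^ (-(2 - D)) / x)
    · have b1 := mul_le_mul_of_nonneg_right hm1 hGp.le
      have b2 := mul_le_mul_of_nonneg_right hm2 p0
      have b3 : 0 ≤ c1 β * P := by positivity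
      linarith
    · have b1 : 0 ≤ Real.exp 4 * G := by positivity
      have b2 : 0 ≤ Real.exp 6 * G := by positivity
      have b3 : 0 ≤ Real.exp 6 * P := by positivity
      unfold CC; linarith
    · refine hxF.trans ?_
      have b0 : 0 ≤ (1 + x) ^ 2 * G := by positivity
      have b1 : 0 ≤ Real.exp 4 * ((1 + x) ^ 2 * G) := by positivity
      have b2 : 0 ≤ Real.exp 6 * ((1 + x) ^ 2 * G) := by positivity
      have b3 : 0 ≤ Real.exp 6 * P := by positivity
      unfold CC; linarith
  · obtain ⟨v1, v2⟩ := V_small (x := x) (h := x / 2) hD0 hβ hx hh hDh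
    rw [← hV] at v1
    rw [← hV1] at v2
    have hh1 : x / 2 ≤ 1 := by linarith
    have hb1 : D * (4 * Real.exp (4 + (x / 2) ^ 2) * (1 + (x / 2) ^ 2) * (1 + x / 2) * (x / 2)) ≤
        1 * (4 * Real.exp (4 + 1 ^ 2) * (1 + 1 ^ 2) * (1 + 1) * 1) := by
      gcongr; linarith
    have hGl : Real.exp 5 ≤ Real.exp 6 * G := by
      rw [hG, ← Real.exp_add, Real.exp_le_exp]; nlinarith
    have e5 : Real.exp (4 + 1 ^ 2) = Real.exp 5 := by norm_num
    rw [e5] at hb1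
    have hb2 : D * (4 * Real.exp (4 + (x / 2) ^ 2) * (1 + (x / 2) ^ 2) * (1 + x / 2) * (x / 2)) ≤
        16 * (Real.exp 6 * G) := by linarith
    have b4 : 0 ≤ Real.exp 4 * G := by positivity
    have b5 : 0 ≤ Real.exp 6 * G := by positivity
    refine ⟨G, 0, hGp.le, le_rfl, le_rfl, by positivity, ?_, ?_, ?_⟩
    · have b1 := mul_le_mul_of_nonneg_right hm1 hGp.le
      linarith
    · unfold CC; linarith
    · refine hxF.trans ?_
      have b0 : G ≤ (1 + x) ^ 2 * G := by nlinarith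
      have b1 : 0 ≤ Real.exp 4 * ((1 + x) ^ 2 * G) := by positivity
      have b2 : Real.exp 6 * G ≤ Real.exp 6 * ((1 + x) ^ 2 * G) := by gcongr
      have b3 : x * V1 ≤ 2 * (16 * (Real.exp 6 * G)) := by
        have : V1 ≤ 16 * (Real.exp 6 * G) := v2.trans hb2
        gcongr
      unfold CC; linarith

set_option maxHeartbeats 1600000 in
lemma env_B {D β x : ℝ} (hD0 : 0 < D) (hD1 : D ≤ 1 / 32) (hβ : β ∈ Ioo (-1 : ℝ) 1) (hx : 2 ≤ x)
    (hDx : 1 ≤ D * x ^ 4) (hX : x ^ 8 * Real.exp (-x) ≤ c1 β / (64 * Real.exp 5)) :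
    Env (min (1 / 2) (c1 β / 2)) CC (π * stableDensity (2 - D) β x) (π * fX (2 - D) β x) x := by
  have hb : |bb D β| ≤ 4 * D := tan_bound hD0 (by linarith) hβ
  have hx0 : 0 < x := by linarith
  have hDh : D * (1 + (1 : ℝ) ^ 2) ≤ 1 / 16 := by linarith
  have hc1 : 0 < c1 β := by unfold c1; have : 0 < 1 + β := by linarith [hβ.1]
                            positivity
  have hc2 : c1 β ≤ 1 := by
    unfold c1
    have : Real.exp (-3) ≤ 1 := by rw [Real.exp_le_one_iff]; norm_num
    nlinarith [hβ.1, hβ.2, Real.exp_pos (-3)]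
  obtain ⟨e1, e2⟩ := decomp (h := 1) hD0 hβ hx0.le zero_le_one hDh
  obtain ⟨n1, n2⟩ := V_nonneg (x := x) (h := 1) hD0 hβ zero_le_one hDh
  obtain ⟨g1, g2⟩ := H_crude (x := x) (h := 1) hD0 hb zero_le_one hDh
  obtain ⟨p0, p1, p2⟩ := P_bounds hD0 (by linarith) (by linarith : 1 ≤ x)
  have vl := V_lower (x := x) (h := 1) hD0 hβ (by linarith)
    (by rw [div_le_one hx0]; linarith) hDh
  obtain ⟨u1, u2⟩ := V_upper (x := x) (h := 1) hD0 hβ hx0 zero_le_one (by linarith) hDh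
  change c1 β * _ ≤ _ at vl
  rw [e1, e2]
  set V := ∫ s in (0 : ℝ)..1, (FC D (bb D β) x ⟨0, -s⟩).im
  set V1 := ∫ s in (0 : ℝ)..1, s * (FC D (bb D β) x ⟨0, -s⟩).im
  set H := (∫ u in Ioi (0 : ℝ), FC D (bb D β) x ⟨u, -1⟩).re
  set H1 := (∫ u in Ioi (0 : ℝ), -Complex.I * (⟨u, -1⟩ : ℂ) * FC D (bb D β) x ⟨u, -1⟩).re
  set P := D * (x ^ (-(2 - D)) / x) with hP
  have hP7 : (x ^ 7)⁻¹ ≤ P := by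
    refine le_trans ?_ p2
    have : (x ^ 7)⁻¹ = 1 / (x ^ 4) * (x ^ 3)⁻¹ := by field_simp
    rw [this]
    gcongr
    rw [div_le_iff₀ (by positivity)]; exact hDx
  have hE : 16 * (1 + (1 : ℝ)) * Real.exp (4 + 1 ^ 2 - x * 1) = 32 * Real.exp 5 * Real.exp (-x) := by
    rw [mul_assoc, mul_assoc, ← Real.exp_add]; norm_num [sub_eq_add_neg]
    rw [← mul_assoc]; norm_num
  rw [hE] at g1 g2
  have hxE : x * (32 * Real.exp 5 * Real.exp (-x)) ≤ c1 β / 2 * P := by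
    rw [le_div_iff₀ (by positivity)] at hX
    have : x * (32 * Real.exp 5 * Real.exp (-x)) =
        (x ^ 8 * Real.exp (-x) * (64 * Real.exp 5)) / 2 * (x ^ 7)⁻¹ := by field_simp; norm_num
    rw [this]
    gcongr
  have hE1 : 32 * Real.exp 5 * Real.exp (-x) ≤ c1 β / 2 * P := by
    refine le_trans ?_ hxE
    have : 0 ≤ 32 * Real.exp 5 * Real.exp (-x) := by positivity
    nlinarith
  have g1' := abs_le.1 (g1.trans hE1)
  have hxH1 : x * |H1| ≤ c1 β / 2 * P := (mul_le_mul_of_nonneg_left g2 hx0.le).trans hxE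
  have hxF : |x * (-V1 + H1)| ≤ x * V1 + x * |H1| := by
    rw [abs_mul, abs_of_nonneg hx0.le, ← mul_add]
    refine mul_le_mul_of_nonneg_left ?_ hx0.le
    refine (abs_add_le _ _).trans ?_
    rw [abs_neg, abs_of_nonneg n2]
  have hm2 : min (1 / 2) (c1 β / 2) ≤ c1 β / 2 := min_le_right _ _
  have b2 := mul_le_mul_of_nonneg_right hm2 p0
  have b3 : c1 β * P ≤ 1 * P := by gcongr
  have b4 : 0 ≤ Real.exp 6 * P := by positivity
  refine ⟨0, P, le_rfl, p0, (Real.exp_pos _).le, p1, ?_, ?_, ?_⟩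
  · linarith [g1'.1]
  · unfold CC; linarith [g1'.2]
  · refine hxF.trans ?_
    unfold CC; linarith

lemma env_all {β : ℝ} (hβ : β ∈ Ioo (-1 : ℝ) 1) :
    ∃ D0 : ℝ, 0 < D0 ∧ D0 ≤ 1 / 32 ∧ ∀ D : ℝ, 0 < D → D ≤ D0 → ∀ x : ℝ, 0 ≤ x →
      Env (min (1 / 2) (c1 β / 2)) CC (π * stableDensity (2 - D) β x) (π * fX (2 - D) β x) x := by
  have hc1 : 0 < c1 β := by unfold c1; have : 0 < 1 + β := by linarith [hβ.1]
                            positivity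
  have hK := KK_pos
  have ht := Real.tendsto_pow_mul_exp_neg_atTop_nhds_zero 8
  have hev := (ht.eventually_le_const (by positivity : 0 < c1 β / (64 * Real.exp 5))).and
    (eventually_ge_atTop 2)
  obtain ⟨X, hX⟩ := eventually_atTop.1 hev
  set N := 64 + 32 * KK + |X| with hN
  have hN64 : 64 ≤ N := by rw [hN]; nlinarith [abs_nonneg X]
  have hNK : 32 * KK ≤ N := by rw [hN]; nlinarith [abs_nonneg X]
  have hNX : X ≤ N := by rw [hN]; nlinarith [le_abs_self X]
  have hN0 : 0 < N := by linarith
  have hN1 : 1 ≤ N ^ 3 := one_le_pow₀ (by linarith)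
  have hN4 : 64 ≤ N ^ 4 := by nlinarith
  refine ⟨1 / (2 * N ^ 4), by positivity, ?_, ?_⟩
  · apply one_div_le_one_div_of_le <;> linarith
  intro D hD0 hD x hx
  rw [le_div_iff₀ (by positivity)] at hD
  rcases le_total (D * x ^ 4) 1 with h | h
  · obtain ⟨h1, h2⟩ := small_A hN64 hNK hD0 hD hx h
    exact env_A hD0 hβ hx h1 h2
  · have hNx : N ≤ x := by
      by_contra hc
      push Not at hc
      have : x ^ 4 ≤ N ^ 4 := by gcongr
      have : D * x ^ 4 ≤ D * N ^ 4 := by gcongr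
      linarith
    obtain ⟨h3, h4⟩ := hX x (hNX.trans hNx)
    exact env_B hD0 (by nlinarith) hβ h4 h h3


lemma dom_J {c C f f1 x : ℝ} (hc : 0 < c) (hC : 0 ≤ C) (hx : 0 ≤ x)
    (h : Env c C (π * f) (π * f1) x) :
    0 ≤ (f + x * f1) ^ 2 / f ∧
    (f + x * f1) ^ 2 / f ≤ 4 * C ^ 2 / c * (1536 * Real.exp 1 + 2) * (1 + x ^ 2)⁻¹ := by
  obtain ⟨g, P, hg, hP, hgG, hP2, hl, hu, hd⟩ := h
  have hpi := Real.pi_pos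
  have hF0 : 0 ≤ π * f := le_trans (by positivity) hl
  have hf0 : 0 ≤ f := nonneg_of_mul_nonneg_right hF0 hpi
  refine ⟨by positivity, ?_⟩
  have hq : (0 : ℝ) < 1 + x ^ 2 := by positivity
  have hB : (1 + x) ^ 4 * g + P ≤ (1536 * Real.exp 1 + 2) * (1 + x ^ 2)⁻¹ := by
    have h1 : (1 + x) ^ 2 ≤ 2 * (1 + x ^ 2) := by nlinarith [sq_nonneg (1 - x)]
    have h2 : (1 + x) ^ 4 ≤ 4 * (1 + x ^ 2) ^ 2 := by
      calc (1 + x) ^ 4 = ((1 + x) ^ 2) ^ 2 := by ring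
        _ ≤ (2 * (1 + x ^ 2)) ^ 2 := by gcongr
        _ = _ := by ring
    have h3 := cube_le_exp hq.le
    have h4 : (1 + x) ^ 4 * g * (1 + x ^ 2) ≤ 1536 * Real.exp 1 := by
      calc (1 + x) ^ 4 * g * (1 + x ^ 2)
          ≤ 4 * (1 + x ^ 2) ^ 2 * Real.exp (-(x ^ 2) / 4) * (1 + x ^ 2) := by gcongr
        _ = 4 * (1 + x ^ 2) ^ 3 * Real.exp (-(x ^ 2) / 4) := by ring
        _ ≤ 4 * (384 * Real.exp ((1 + x ^ 2) / 4)) * Real.exp (-(x ^ 2) / 4) := by gcongr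
        _ = 1536 * Real.exp (1 / 4) := by
          have : Real.exp ((1 + x ^ 2) / 4) * Real.exp (-(x ^ 2) / 4) = Real.exp (1 / 4) := by
            rw [← Real.exp_add]; congr 1; ring
          rw [← this]; ring
        _ ≤ 1536 * Real.exp 1 := by gcongr; norm_num
    rw [← le_div_iff₀ hq] at h4
    rw [add_mul, ← div_eq_mul_inv, ← div_eq_mul_inv]
    linarith
  have hN : |π * (f + x * f1)| ≤ 2 * C * ((1 + x) ^ 2 * g + P) := by
    have e : π * (f + x * f1) = π * f + x * (π * f1) := by ring
    rw [e]
    refine (abs_add_le _ _).trans ?_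
    rw [abs_of_nonneg hF0]
    have : g ≤ (1 + x) ^ 2 * g := by nlinarith
    have : C * (g + P) ≤ C * ((1 + x) ^ 2 * g + P) := by gcongr
    linarith
  have hcs : ((1 + x) ^ 2 * g + P) ^ 2 ≤ ((1 + x) ^ 4 * g + P) * (g + P) := by
    have h5 : 2 * (1 + x) ^ 2 ≤ (1 + x) ^ 4 + 1 := by nlinarith [sq_nonneg ((1 + x) ^ 2 - 1)]
    have : 2 * (1 + x) ^ 2 * (g * P) ≤ ((1 + x) ^ 4 + 1) * (g * P) := by gcongr
    nlinarith
  have hsq : π ^ 2 * (f + x * f1) ^ 2 ≤ 4 * C ^ 2 * (((1 + x) ^ 4 * g + P) * (g + P)) := by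
    calc π ^ 2 * (f + x * f1) ^ 2 = |π * (f + x * f1)| ^ 2 := by rw [sq_abs]; ring
      _ ≤ (2 * C * ((1 + x) ^ 2 * g + P)) ^ 2 := by gcongr
      _ = 4 * C ^ 2 * ((1 + x) ^ 2 * g + P) ^ 2 := by ring
      _ ≤ _ := by gcongr
  have hfin : π * (f + x * f1) ^ 2 ≤ 4 * C ^ 2 / c * ((1 + x) ^ 4 * g + P) * f := by
    have h6 : g + P ≤ π * f / c := by rw [le_div_iff₀ hc]; linarith
    have h7 : π ^ 2 * (f + x * f1) ^ 2 ≤ 4 * C ^ 2 * (((1 + x) ^ 4 * g + P) * (π * f / c)) :=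
      hsq.trans (by gcongr)
    have h8 : π * (π * (f + x * f1) ^ 2) ≤ π * (4 * C ^ 2 / c * ((1 + x) ^ 4 * g + P) * f) := by
      refine le_trans (le_of_eq (by ring)) (h7.trans (le_of_eq (by ring)))
    exact le_of_mul_le_mul_left h8 hpi
  have hpi1 : 1 ≤ π := by linarith [Real.pi_gt_three]
  apply div_le_of_le_mul₀ hf0 (by positivity)
  calc (f + x * f1) ^ 2 ≤ π * (f + x * f1) ^ 2 := by nlinarith [sq_nonneg (f + x * f1)]
    _ ≤ 4 * C ^ 2 / c * ((1 + x) ^ 4 * g + P) * f := hfin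
    _ ≤ 4 * C ^ 2 / c * ((1536 * Real.exp 1 + 2) * (1 + x ^ 2)⁻¹) * f := by gcongr
    _ = _ := by ring

lemma tendsto_of_lin {φ : ℝ → ℝ} {a A δ : ℝ} (hδ : 0 < δ)
    (h : ∀ D, 0 < D → D ≤ δ → |φ D - a| ≤ D * A) : Tendsto φ (𝓝[>] 0) (𝓝 a) := by
  rw [tendsto_iff_norm_sub_tendsto_zero]
  refine squeeze_zero' (Eventually.of_forall fun _ => norm_nonneg _) (g := fun D => D * A) ?_ ?_
  · filter_upwards [Ioc_mem_nhdsGT hδ] with D hD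
    exact h D hD.1 hD.2
  · have : Tendsto (fun D : ℝ => D * A) (𝓝 0) (𝓝 (0 * A)) := tendsto_id.mul_const A
    rw [zero_mul] at this
    exact this.mono_left nhdsWithin_le_nhds

lemma pt_limits {β x : ℝ} (hβ : β ∈ Ioo (-1 : ℝ) 1) (hx : 0 ≤ x) :
    Tendsto (fun D => π * stableDensity (2 - D) β x) (𝓝[>] 0)
      (𝓝 (Real.exp (-(x ^ 2) / 4) * (√π / 2))) ∧
    Tendsto (fun D => π * fX (2 - D) β x) (𝓝[>] 0)
      (𝓝 (-(x / 2) * (Real.exp (-(x ^ 2) / 4) * (√π / 2)))) := by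
  have hh : 0 ≤ x / 2 := by positivity
  have hδ : 0 < 1 / (16 * (1 + (x / 2) ^ 2)) := by positivity
  have key : ∀ D, 0 < D → D ≤ 1 / (16 * (1 + (x / 2) ^ 2)) →
      |bb D β| ≤ 4 * D ∧ D * (1 + (x / 2) ^ 2) ≤ 1 / 16 := by
    intro D hD0 hD
    rw [le_div_iff₀ (by positivity)] at hD
    have h2 : D * (1 + (x / 2) ^ 2) ≤ 1 / 16 := by linarith
    have hD1 : D ≤ 1 / 16 := by nlinarith [mul_nonneg hD0.le (sq_nonneg (x / 2))]
    exact ⟨tan_bound hD0 hD1 hβ, h2⟩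
  set W := 4 * Real.exp (4 + (x / 2) ^ 2) * (1 + (x / 2) ^ 2) * (1 + x / 2) * (x / 2) with hW
  set G := Real.exp (-(x ^ 2) / 4) with hG
  constructor
  · refine tendsto_of_lin (A := W + 4 * KK * (1 + (x / 2) ^ 3) * G) hδ fun D hD0 hD => ?_
    obtain ⟨hb, hDh⟩ := key D hD0 hD
    rw [(decomp hD0 hβ hx hh hDh).1]
    have n1 := (V_nonneg (x := x) hD0 hβ hh hDh).1
    have g1 := abs_le.1 (H_gauss hD0 hb hx hDh).1
    have v1 := (V_small (x := x) (h := x / 2) hD0 hβ hx hh hDh).1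
    rw [← hG] at g1
    rw [← hW] at v1
    have hw : 0 ≤ D * W := n1.trans v1
    rw [abs_le]; constructor
    · linarith [g1.1]
    · linarith [g1.2]
  · refine tendsto_of_lin (A := W + 4 * KK * (1 + (x / 2) ^ 3) * G * (1 + x / 2)) hδ
      fun D hD0 hD => ?_
    obtain ⟨hb, hDh⟩ := key D hD0 hD
    rw [(decomp hD0 hβ hx hh hDh).2]
    have n1 := (V_nonneg (x := x) hD0 hβ hh hDh).2
    have g1 := abs_le.1 (H_gauss hD0 hb hx hDh).2
    have v1 := (V_small (x := x) (h := x / 2) hD0 hβ hx hh hDh).2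
    rw [← hG] at g1
    rw [← hW] at v1
    have hw : 0 ≤ D * W := n1.trans v1
    rw [abs_le]; constructor
    · linarith [g1.1]
    · linarith [g1.2]

lemma pt_J {β x : ℝ} (hβ : β ∈ Ioo (-1 : ℝ) 1) (hx : 0 ≤ x) :
    Tendsto (fun D => (stableDensity (2 - D) β x + x * fX (2 - D) β x) ^ 2 /
      stableDensity (2 - D) β x) (𝓝[>] 0)
      (𝓝 (√π / (2 * π) * ((1 - x ^ 2 + x ^ 4 / 4) * Real.exp (-(x ^ 2) / 4)))) := by
  obtain ⟨t1, t2⟩ := pt_limits hβ hx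
  have hpi := Real.pi_pos
  set G := Real.exp (-(x ^ 2) / 4) with hG
  have hGp : 0 < G := Real.exp_pos _
  have h1 := ((t1.add (t2.const_mul x)).pow 2).div (t1.const_mul π) (by positivity)
  have e : (G * (√π / 2) + x * (-(x / 2) * (G * (√π / 2)))) ^ 2 / (π * (G * (√π / 2))) =
      √π / (2 * π) * ((1 - x ^ 2 + x ^ 4 / 4) * G) := by
    have hs : 0 < √π := Real.sqrt_pos.2 hpi
    field_simp
    ring
  rw [e] at h1
  refine h1.congr fun D => ?_
  have e1 : (π * stableDensity (2 - D) β x + x * (π * fX (2 - D) β x)) ^ 2 =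
      (π * π) * (stableDensity (2 - D) β x + x * fX (2 - D) β x) ^ 2 := by ring
  change (π * stableDensity (2 - D) β x + x * (π * fX (2 - D) β x)) ^ 2 /
    (π * (π * stableDensity (2 - D) β x)) = _
  rw [e1, ← mul_assoc, mul_div_mul_left _ _ (by positivity)]

lemma limit_integral :
    ∫ x in Ioi (0 : ℝ), √π / (2 * π) * ((1 - x ^ 2 + x ^ 4 / 4) * Real.exp (-(x ^ 2) / 4)) = 1 := by
  have hpi := Real.pi_pos
  have hm : ∀ n : ℕ, IntegrableOn (fun x : ℝ => x ^ n * Real.exp (-(x ^ 2) / 4)) (Ioi 0) ∧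
      ∫ x in Ioi (0 : ℝ), x ^ n * Real.exp (-(x ^ 2) / 4) =
        (1 / 4 : ℝ) ^ (-((n : ℝ) + 1) / 2) * (1 / 2) * Real.Gamma (((n : ℝ) + 1) / 2) := by
    intro n
    have hn : (-1 : ℝ) < n := by have : (0 : ℝ) ≤ n := Nat.cast_nonneg n
                                 linarith
    have e : EqOn (fun x : ℝ => x ^ (n : ℝ) * Real.exp (-(1 / 4) * x ^ (2 : ℝ)))
        (fun x : ℝ => x ^ n * Real.exp (-(x ^ 2) / 4)) (Ioi 0) := by
      intro x hx
      simp only [Real.rpow_natCast, Real.rpow_two]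
      congr 2; ring
    constructor
    · refine IntegrableOn.congr_fun ?_ e measurableSet_Ioi
      exact integrableOn_rpow_mul_exp_neg_mul_rpow hn (by norm_num) (by norm_num)
    · rw [← setIntegral_congr_fun measurableSet_Ioi e]
      exact integral_rpow_mul_exp_neg_mul_rpow (by norm_num) hn (by norm_num)
  obtain ⟨i0, v0⟩ := hm 0
  obtain ⟨i2, v2⟩ := hm 2
  obtain ⟨i4, v4⟩ := hm 4
  have e4 : (1 / 4 : ℝ) = (2 : ℝ) ^ (-2 : ℝ) := by rw [Real.rpow_neg (by norm_num)]; norm_num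
  have g0 : Real.Gamma (((0 : ℕ) + 1 : ℝ) / 2) = √π := by
    rw [← Real.Gamma_one_half_eq]; norm_num
  have g2 : Real.Gamma (((2 : ℕ) + 1 : ℝ) / 2) = √π / 2 := by
    rw [show (((2 : ℕ) + 1 : ℝ) / 2) = 1 / 2 + 1 by norm_num, Real.Gamma_add_one (by norm_num),
      Real.Gamma_one_half_eq]; ring
  have g4 : Real.Gamma (((4 : ℕ) + 1 : ℝ) / 2) = 3 * √π / 4 := by
    rw [show (((4 : ℕ) + 1 : ℝ) / 2) = (1 / 2 + 1) + 1 by norm_num,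
      Real.Gamma_add_one (by norm_num), Real.Gamma_add_one (by norm_num),
      Real.Gamma_one_half_eq]; ring
  have p : ∀ n : ℕ, (1 / 4 : ℝ) ^ (-((n : ℝ) + 1) / 2) = 2 ^ (n + 1) := by
    intro n
    rw [e4, ← Real.rpow_mul (by norm_num), ← Real.rpow_natCast]
    congr 1; push_cast; ring
  rw [p, g0] at v0
  rw [p, g2] at v2
  rw [p, g4] at v4
  have e : ∀ x : ℝ, (1 - x ^ 2 + x ^ 4 / 4) * Real.exp (-(x ^ 2) / 4) =
      x ^ 0 * Real.exp (-(x ^ 2) / 4) - x ^ 2 * Real.exp (-(x ^ 2) / 4) +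
        1 / 4 * (x ^ 4 * Real.exp (-(x ^ 2) / 4)) := by intro x; ring
  have i02 : IntegrableOn (fun x : ℝ => x ^ 0 * Real.exp (-(x ^ 2) / 4) -
    x ^ 2 * Real.exp (-(x ^ 2) / 4)) (Ioi 0) := i0.sub i2
  rw [integral_const_mul]
  simp only [e]
  rw [integral_add i02 (i4.const_mul _), integral_sub i0 i2, integral_const_mul, v0, v2, v4]
  have hs : √π * √π = π := Real.mul_self_sqrt hpi.le
  field_simp
  rw [Real.sq_sqrt hpi.le]
  ring

lemma conj_sym (α β x : ℝ) : stableDensity α β (-x) = stableDensity α (-β) x := by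
  unfold stableDensity
  congr 1
  rw [← Complex.conj_re, ← integral_conj]
  congr 2
  ext t
  rw [map_mul, ← Complex.exp_conj, ← Complex.exp_conj]
  simp only [map_neg, map_mul, map_add, map_sub, map_one, Complex.conj_I, Complex.conj_ofReal,
    Complex.ofReal_neg]
  congr 2 <;> ring

lemma fX_sym (α β x : ℝ) : fX α β (-x) = - fX α (-β) x := by
  unfold fX
  have : stableDensity α (-β) = fun y => stableDensity α β (-y) := by
    ext y; exact (conj_sym α β y).symm
  rw [this, deriv_comp_neg]
  simp

/-- The Fisher integrand. -/
noncomputable def JJ (D β x : ℝ) : ℝ :=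
  (stableDensity (2 - D) β x + x * fX (2 - D) β x) ^ 2 / stableDensity (2 - D) β x

lemma JJ_sym (D β x : ℝ) : JJ D β (-x) = JJ D (-β) x := by
  unfold JJ
  rw [conj_sym, fX_sym]
  congr 2; ring

lemma half_line {β : ℝ} (hβ : β ∈ Ioo (-1 : ℝ) 1) :
    (∀ᶠ D in 𝓝[>] (0 : ℝ), IntegrableOn (JJ D β) (Ioi 0)) ∧
    Tendsto (fun D => ∫ x in Ioi (0 : ℝ), JJ D β x) (𝓝[>] 0) (𝓝 1) := by
  obtain ⟨D0, hD0, hD1, henv⟩ := env_all hβ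
  have hc : 0 < min (1 / 2) (c1 β / 2) := by
    have : 0 < 1 + β := by linarith [hβ.1]
    unfold c1; positivity
  have hC : 0 ≤ CC := by unfold CC; positivity
  set M := 4 * CC ^ 2 / min (1 / 2) (c1 β / 2) * (1536 * Real.exp 1 + 2)
  have hmeas : ∀ᶠ D in 𝓝[>] (0 : ℝ),
      AEStronglyMeasurable (JJ D β) (volume.restrict (Ioi 0)) := by
    filter_upwards [Ioc_mem_nhdsGT hD0] with D hD
    have hb := tan_bound (β := β) hD.1 (by linarith [hD.2]) hβ
    have hdiff : Differentiable ℝ (stableDensity (2 - D) β) := fun x =>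
      (hasDerivAt_stableDensity hD.1 (by linarith [hD.2]) hb x).differentiableAt
    have m1 : Measurable (stableDensity (2 - D) β) := hdiff.continuous.measurable
    have m2 : Measurable (fX (2 - D) β) := measurable_deriv _
    exact (((m1.add (measurable_id.mul m2)).pow_const 2).div m1).aestronglyMeasurable
  have hbd : ∀ᶠ D in 𝓝[>] (0 : ℝ), ∀ᵐ x ∂(volume.restrict (Ioi (0 : ℝ))),
      ‖JJ D β x‖ ≤ M * (1 + x ^ 2)⁻¹ := by
    filter_upwards [Ioc_mem_nhdsGT hD0] with D hD
    refine (ae_restrict_iff' measurableSet_Ioi).2 (Eventually.of_forall fun x hx => ?_)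
    have h := dom_J hc hC (le_of_lt hx) (henv D hD.1 hD.2 x (le_of_lt hx))
    change ‖(stableDensity (2 - D) β x + x * fX (2 - D) β x) ^ 2 / stableDensity (2 - D) β x‖ ≤ _
    rw [Real.norm_of_nonneg h.1]
    exact h.2
  have hIntg : Integrable (fun x : ℝ => M * (1 + x ^ 2)⁻¹) (volume.restrict (Ioi (0 : ℝ))) :=
    (integrable_inv_one_add_sq.const_mul M).integrableOn
  constructor
  · filter_upwards [hmeas, hbd] with D h1 h2
    exact hIntg.mono' h1 h2
  · rw [← limit_integral]
    refine tendsto_integral_filter_of_dominated_convergence _ hmeas hbd hIntg ?_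
    refine (ae_restrict_iff' measurableSet_Ioi).2 (Eventually.of_forall fun x hx => ?_)
    exact pt_J hβ (le_of_lt hx)

lemma main_aux (β : ℝ) (hβ : β ∈ Ioo (-1 : ℝ) 1) :
    Tendsto (fun D => ∫ x : ℝ, JJ D β x) (𝓝[>] 0) (𝓝 2) := by
  obtain ⟨i1, t1⟩ := half_line hβ
  obtain ⟨i2, t2⟩ := half_line (β := -β) ⟨by linarith [hβ.2], by linarith [hβ.1]⟩
  have h := t2.add t1
  norm_num at h
  refine h.congr' ?_
  filter_upwards [i1, i2] with D h1 h2
  have e : ∫ x in Ioi (0 : ℝ), JJ D (-β) x = ∫ x in Iic (0 : ℝ), JJ D β x := by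
    have := integral_comp_neg_Ioi (0 : ℝ) (JJ D β)
    simp only [JJ_sym, neg_zero] at this
    exact this
  have h3 : IntegrableOn (JJ D β) (Iic 0) := by
    have h4 : IntegrableOn (JJ D (-β)) (Ici (- -(0 : ℝ))) := by
      rw [neg_neg]
      exact (integrableOn_Ici_iff_integrableOn_Ioi (by simp)).2 h2
    have h5 : JJ D β = fun x => JJ D (-β) (-x) := by
      ext x; rw [JJ_sym, neg_neg]
    rw [h5]
    have h6 := h4.comp_neg_Iic
    rwa [neg_zero] at h6
  rw [e, intervalIntegral.integral_Iic_add_Ioi h3 h1]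

theorem fisher_information_sigma_sigma (β : ℝ) (hβ : β ∈ Set.Ioo (-1 : ℝ) 1) :
    Filter.Tendsto
      (fun Δ : ℝ =>
        ∫ x : ℝ, (stableDensity (2 - Δ) β x + x * fX (2 - Δ) β x) ^ 2 /
          stableDensity (2 - Δ) β x)
      (nhdsWithin 0 (Set.Ioi 0)) (nhds 2) := by
  exact main_aux β hβ
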